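/- arXiv:math/0208172 — 2 statements merged into one kernel-verified Lean document; each statement's English description precedes it below -/
import Mathlib

section
/- Let (R,m,k) be a generically Gorenstein commutative noetherian local ring admitting a dualizing complex D^R, normalized so that H_i(D^R) = 0 for i < 0 and H_0(D^R) ≠ 0. If Ext^i_R(D^R, R) = 0 for all i with 1 ≤ i ≤ dim R, then R is Gorenstein. -/
open CategoryTheory CategoryTheory.Limits CochainComplex.HomComplex

noncomputable section

/-- The category of cochain complexes of `R`-modules indexed by `ℤ`.  We identify a chain
complex with homology `H_i` with the cochain complex whose cohomology in degree `n` is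
`H_{-n}`. -/
abbrev Cx (R : Type) [CommRing R] := CochainComplex (ModuleCat R) ℤ

/-- The complex consisting of the module `M` concentrated in degree `0`. -/
abbrev sgl {R : Type} [CommRing R] (M : ModuleCat R) : Cx R :=
  (HomologicalComplex.single (ModuleCat R) (ComplexShape.up ℤ) 0).obj M

/-- `π : F ⟶ M` is a semiprojective resolution of `M`:  `F` is a bounded above
complex of projective modules and `π` is a quasi-isomorphism. -/
def IsSemiprojResolution {R : Type} [CommRing R] {F M : Cx R} (π : F ⟶ M) : Prop :=
  (∀ n : ℤ, Projective (F.X n)) ∧ (∃ b : ℤ, ∀ n : ℤ, b ≤ n → IsZero (F.X n)) ∧ QuasiIso π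

/-- Vanishing of the hyper-Ext group `Ext^i(M, N)`:  computed from any semiprojective
resolution `F` of `M`, every `i`-cocycle of the Hom-complex `Hom(F, N)` is a coboundary. -/
def ExtVanishes {R : Type} [CommRing R] (M N : Cx R) (i : ℤ) : Prop :=
  ∀ (F : Cx R) (π : F ⟶ M), IsSemiprojResolution π →
    ∀ f : Cochain F N i, δ i (i+1) f = 0 → ∃ g : Cochain F N (i-1), δ (i-1) i g = f

/-- The `i`-th hyper-Ext module computed from a resolution `F` of the first variable:
the cocycles modulo the coboundaries in the Hom-complex `Hom(F, N)`. -/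
abbrev extModule (R : Type) [CommRing R] (F N : Cx R) (i : ℤ) :=
  ↥(LinearMap.ker (δ_hom R F N i (i+1))) ⧸
    (Submodule.comap (LinearMap.ker (δ_hom R F N i (i+1))).subtype
      (LinearMap.range (δ_hom R F N (i-1) i)))

/-- `Ext^i(M, N) ≅ k`, the residue field of the local ring `R`. -/
def ExtIsResidueField (R : Type) [CommRing R] [IsLocalRing R] (M N : Cx R) (i : ℤ) : Prop :=
  ∀ (F : Cx R) (π : F ⟶ M), IsSemiprojResolution π →
    Nonempty ((extModule R F N i) ≃ₗ[R] (R ⧸ IsLocalRing.maximalIdeal R))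

/-- `D` is a dualizing complex for the local ring `R`, normalized so that
`H_i(D) = 0` for `i < 0` and `H_0(D) ≠ 0` (recall `H_i(D) = H^{-i}(D)`):  it has bounded,
degreewise finitely generated homology and `Ext^i(k, D)` is `k` for exactly one `i` and
zero otherwise. -/
structure IsNormalizedDualizingComplex (R : Type) [CommRing R] [IsLocalRing R] (D : Cx R) :
    Prop where
  finite_homology : ∀ n : ℤ, Module.Finite R (D.homology n)
  homology_bounded : ∃ a : ℤ, ∀ n : ℤ, n < a → IsZero (D.homology n)
  vanish_neg : ∀ n : ℤ, 0 < n → IsZero (D.homology n)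
  nonzero_zero : ¬ IsZero (D.homology 0)
  ext_residue : ∃ d : ℤ,
    ExtIsResidueField R (sgl (ModuleCat.of R (R ⧸ IsLocalRing.maximalIdeal R))) D d ∧
    ∀ i : ℤ, i ≠ d →
      ExtVanishes (sgl (ModuleCat.of R (R ⧸ IsLocalRing.maximalIdeal R))) D i

/-- The depth of a local ring: the smallest `i` with `Ext^i(k, R) ≠ 0`. -/
def ringDepth (R : Type) [CommRing R] [IsLocalRing R] : ℕ∞ :=
  sInf { n : ℕ∞ | ∃ i : ℕ, n = i ∧
    ¬ IsZero (((Ext R (ModuleCat R) i).obj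
        (Opposite.op (ModuleCat.of R (R ⧸ IsLocalRing.maximalIdeal R)))).obj
        (ModuleCat.of R R)) }

/-- A local ring is Cohen-Macaulay if its depth equals its Krull dimension. -/
def IsCohenMacaulayLocalRing (R : Type) [CommRing R] [IsLocalRing R] : Prop :=
  (ringDepth R : WithBot ℕ∞) = ringKrullDim R

/-- `R` has finite injective dimension as a module over itself. -/
def HasFiniteSelfInjDim (R : Type) [CommRing R] : Prop :=
  ∃ n : ℕ, ∀ (M : ModuleCat R) (i : ℕ), n < i →
    IsZero (((Ext R (ModuleCat R) i).obj (Opposite.op M)).obj (ModuleCat.of R R))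

/-- A Gorenstein local ring: a noetherian local ring of finite self-injective dimension. -/
def IsGorensteinLocalRing (R : Type) [CommRing R] : Prop :=
  IsNoetherianRing R ∧ IsLocalRing R ∧ HasFiniteSelfInjDim R

/-- A commutative ring is generically Gorenstein if its localization at every
associated prime is a Gorenstein (local) ring. -/
def IsGenericallyGorenstein (R : Type) [CommRing R] : Prop :=
  ∀ (p : Ideal R) (hp : p.IsPrime), p ∈ associatedPrimes R R →
    IsGorensteinLocalRing (@Localization.AtPrime R _ p hp)

lemma PrimeSpectrum.wellFoundedGT (R : Type*) [CommRing R] [IsNoetherianRing R] :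
    WellFoundedGT (PrimeSpectrum R) :=
  StrictMono.wellFoundedGT (f := PrimeSpectrum.asIdeal) fun _ _ h ↦ h

namespace Module

variable {R : Type*} [CommRing R] {X Y Z : Type*} [AddCommGroup X] [Module R X]
  [AddCommGroup Y] [Module R Y] [AddCommGroup Z] [Module R Z]

lemma support_subset_union_of_exact {f : X →ₗ[R] Y} {g : Y →ₗ[R] Z} (h : Function.Exact f g) :
    support R Y ⊆ support R X ∪ support R Z := by
  intro p hp
  by_contra hc
  simp only [Set.mem_union, not_or, notMem_support_iff'] at hc
  refine (notMem_support_iff'.2 fun y ↦ ?_) hp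
  obtain ⟨r, hr, hry⟩ := hc.2 (g y)
  obtain ⟨x, hx⟩ := (h (r • y)).1 (by rw [map_smul, hry])
  obtain ⟨s, hs, hsx⟩ := hc.1 x
  exact ⟨s * r, p.2.mul_notMem hs hr, by rw [mul_smul, ← hx, ← map_smul, hsx, map_zero]⟩

lemma notMem_support_of_exact_smul [Module.Finite R X] {p : PrimeSpectrum R} {x : R}
    (hx : x ∈ p.asIdeal) {g : X →ₗ[R] Z} (h : Function.Exact (fun z : X ↦ x • z) g)
    (hp : p ∉ support R Z) : p ∉ support R X := by
  open scoped Pointwise in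
  intro hX
  have hle : x • (⊤ : Submodule R X) ≤ LinearMap.ker g := by
    rintro _ ⟨z, -, rfl⟩
    exact (h _).2 ⟨z, rfl⟩
  refine hp (support_subset_of_injective ((x • (⊤ : Submodule R X)).liftQ g hle) ?_ ?_)
  · rw [← LinearMap.ker_eq_bot, Submodule.ker_liftQ_eq_bot]
    intro z hz
    obtain ⟨w, rfl⟩ := (h z).1 hz
    exact ⟨w, trivial, rfl⟩
  · have : p ∈ support R (QuotSMulTop x X) := by
      rw [support_quotSMulTop]
      exact ⟨hX, by simpa using hx⟩
    exact this

lemma notMem_support_of_subsingleton {p : PrimeSpectrum R} (h : Subsingleton X) :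
    p ∉ support R X := by
  simp [support_eq_empty]

end Module

/-- A contravariant cohomological `δ`-functor, indexed by `ℤ`, on the category of modules over
a commutative ring `R`, on which multiplication by scalars acts as expected. -/
structure CohomologicalFunctor.{w} (R : Type) [CommRing R] where
  obj : ℤ → ModuleCat.{0} R → ModuleCat.{w} R
  map (j : ℤ) {N N' : ModuleCat.{0} R} (f : N ⟶ N') : obj j N' →ₗ[R] obj j N
  map_comp (j : ℤ) {N N' N'' : ModuleCat.{0} R} (f : N ⟶ N') (g : N' ⟶ N'') :
    map j (f ≫ g) = map j f ∘ₗ map j g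
  map_smul_id (j : ℤ) (N : ModuleCat.{0} R) (x : R) :
    map j (x • 𝟙 N) = x • LinearMap.id
  δ {S : ShortComplex (ModuleCat.{0} R)} (hS : S.ShortExact) (j : ℤ) :
    obj j S.X₁ →ₗ[R] obj (j + 1) S.X₃
  exact₂ {S : ShortComplex (ModuleCat.{0} R)} (hS : S.ShortExact) (j : ℤ) :
    Function.Exact (map j S.g) (map j S.f)
  exact₁ {S : ShortComplex (ModuleCat.{0} R)} (hS : S.ShortExact) (j : ℤ) :
    Function.Exact (map j S.f) (δ hS j)
  exact₃ {S : ShortComplex (ModuleCat.{0} R)} (hS : S.ShortExact) (j : ℤ) :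
    Function.Exact (δ hS j) (map (j + 1) S.g)

namespace CohomologicalFunctor

variable {R : Type} [CommRing R] (T : CohomologicalFunctor R)

lemma map_id (j : ℤ) (N : ModuleCat.{0} R) : T.map j (𝟙 N) = LinearMap.id := by
  simpa using T.map_smul_id j N 1

/-- The isomorphism induced by an isomorphism of modules. -/
def mapEquiv (j : ℤ) {N N' : ModuleCat.{0} R} (e : N ≅ N') : T.obj j N' ≃ₗ[R] T.obj j N :=
  LinearEquiv.ofLinearMap (T.map j e.hom) (T.map j e.inv)
    (by rw [← map_comp, e.hom_inv_id, map_id]) (by rw [← map_comp, e.inv_hom_id, map_id])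

lemma smul_obj_eq_zero (j : ℤ) {N : ModuleCat.{0} R} {x : R} (hx : ∀ n : N, x • n = 0)
    (z : T.obj j N) : x • z = 0 := by
  have h1 : x • 𝟙 N = (0 : R) • 𝟙 N := 
    ModuleCat.hom_ext (LinearMap.ext fun n ↦ (hx n).trans (zero_smul R n).symm)
  have := LinearMap.congr_fun (T.map_smul_id j N x) z
  rw [h1, T.map_smul_id] at this
  exact this.symm.trans (zero_smul R z)

lemma annihilator_le (j : ℤ) {N : ModuleCat.{0} R} :
    Module.annihilator R N ≤ Module.annihilator R (T.obj j N) := by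
  intro x hx
  rw [Module.mem_annihilator] at hx ⊢
  exact T.smul_obj_eq_zero j hx

lemma subsingleton_obj (j : ℤ) {N : ModuleCat.{0} R} [Subsingleton N] :
    Subsingleton (T.obj j N) :=
  ⟨fun a b ↦ by
    have (z : T.obj j N) : z = 0 := by
      simpa using T.smul_obj_eq_zero j (x := 1) (fun n ↦ Subsingleton.elim _ _) z
    rw [this a, this b]⟩

/-- The short exact sequence `0 → R/P → R/P → R/(P + xR) → 0`. -/
lemma shortExact_smul_quotient_prime (P : PrimeSpectrum R) {x : R} (hx : x ∉ P.asIdeal) :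
    ((ModuleCat.of R (R ⧸ P.asIdeal)).smulShortComplex x).ShortExact := by
  apply IsSMulRegular.smulShortComplex_shortExact
  intro a b hab
  obtain ⟨a, rfl⟩ := Ideal.Quotient.mk_surjective a
  obtain ⟨b, rfl⟩ := Ideal.Quotient.mk_surjective b
  rw [Ideal.Quotient.eq]
  have h : Ideal.Quotient.mk P.asIdeal (x * a) = Ideal.Quotient.mk P.asIdeal (x * b) := hab
  rw [Ideal.Quotient.eq, ← mul_sub] at h
  exact (P.2.mem_or_mem h).resolve_left hx

lemma lt_of_mem_support_quotSMulTop {P Q : PrimeSpectrum R} {x : R} (hx : x ∉ P.asIdeal)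
    (hQ : Q ∈ Module.support R (QuotSMulTop x (R ⧸ P.asIdeal))) : P < Q := by
  rw [Module.support_quotSMulTop, Set.mem_inter_iff, Module.mem_support_iff_of_finite,
    Ideal.annihilator_quotient] at hQ
  refine lt_of_le_of_ne hQ.1 ?_
  rintro rfl
  exact hx (by simpa using hQ.2)

lemma exact_smul_δ (j : ℤ) (P : PrimeSpectrum R) {x : R} (hx : x ∉ P.asIdeal) :
    Function.Exact (fun z : T.obj j (ModuleCat.of R (R ⧸ P.asIdeal)) ↦ x • z)
      (T.δ (shortExact_smul_quotient_prime P hx) j) := by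
  have h := T.exact₁ (shortExact_smul_quotient_prime P hx) j
  rw [ModuleCat.smulShortComplex_f_eq_smul_id] at h
  have h2 := T.map_smul_id j (ModuleCat.of R (R ⧸ P.asIdeal)) x
  intro z
  rw [h z]
  constructor
  · rintro ⟨w, hw⟩
    exact ⟨w, by rw [← hw]; exact (LinearMap.congr_fun h2 w).symm⟩
  · rintro ⟨w, hw⟩
    exact ⟨w, by rw [← hw]; exact (LinearMap.congr_fun h2 w)⟩

lemma notMem_support_of_quotSMulTop
    (hfin : ∀ (j : ℤ) (N : ModuleCat.{0} R), Module.Finite R N → Module.Finite R (T.obj j N))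
    (j : ℤ) (P q : PrimeSpectrum R) {x : R}
    (hx : x ∉ P.asIdeal) (hxq : x ∈ q.asIdeal)
    (h : q ∉ Module.support R (T.obj (j + 1)
      (ModuleCat.of R (QuotSMulTop x (R ⧸ P.asIdeal))))) :
    q ∉ Module.support R (T.obj j (ModuleCat.of R (R ⧸ P.asIdeal))) := by
  have := hfin j (ModuleCat.of R (R ⧸ P.asIdeal))
    (inferInstanceAs (Module.Finite R (R ⧸ P.asIdeal)))
  exact Module.notMem_support_of_exact_smul hxq (T.exact_smul_δ j P hx) h

section Noetherian

variable [IsNoetherianRing R]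

/-- If `q` lies in the support of `T^j(N)`, it lies in the support of `T^j(R/P)` for some `P`
in the support of `N`. -/
lemma exists_mem_support_quotient_prime (j : ℤ) (N : Type) [AddCommGroup N] [Module R N]
    [Module.Finite R N] {q : PrimeSpectrum R}
    (hq : q ∈ Module.support R (T.obj j (ModuleCat.of R N))) :
    ∃ P ∈ Module.support R N, P ≤ q ∧
      q ∈ Module.support R (T.obj j (ModuleCat.of R (R ⧸ P.asIdeal))) := by
  induction ‹Module.Finite R N› using
    IsNoetherianRing.induction_on_isQuotientEquivQuotientPrime R with
  | subsingleton N =>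
    exact absurd hq (Module.notMem_support_of_subsingleton
      (T.subsingleton_obj j (N := ModuleCat.of R N)))
  | quotient N p f =>
    rw [(T.mapEquiv j f.toModuleIso).support_eq.symm] at hq
    refine ⟨p, ?_, ?_, hq⟩
    · rw [f.support_eq, Module.mem_support_iff_of_finite, Ideal.annihilator_quotient]
    · have := (T.annihilator_le j).trans (Module.annihilator_le_of_mem_support hq)
      exact (Ideal.annihilator_quotient (I := p.asIdeal)).symm.le.trans this
  | exact N₁ N₂ N₃ f g hf hg hfg h₁ h₃ =>
    have hS : (ModuleCat.shortComplexOfCompEqZero f g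
        hfg.linearMap_comp_eq_zero).ShortExact :=
      { exact := ModuleCat.shortComplex_exact _ hfg
        mono_f := (ModuleCat.mono_iff_injective _).2 hf
        epi_g := (ModuleCat.epi_iff_surjective _).2 hg }
    rcases Module.support_subset_union_of_exact (T.exact₂ hS j) hq with h | h
    · obtain ⟨P, hP, h⟩ := h₃ h
      exact ⟨P, Module.support_subset_of_surjective g hg hP, h⟩
    · obtain ⟨P, hP, h⟩ := h₁ h
      exact ⟨P, Module.support_subset_of_injective f hf hP, h⟩

lemma subsingleton_of_forall_prime (j : ℤ) (N : Type) [AddCommGroup N] [Module R N]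
    [Module.Finite R N] (h : ∀ P ∈ Module.support R N,
      Subsingleton (T.obj j (ModuleCat.of R (R ⧸ P.asIdeal)))) :
    Subsingleton (T.obj j (ModuleCat.of R N)) := by
  rw [← Module.support_eq_empty_iff (R := R), Set.eq_empty_iff_forall_notMem]
  intro q hq
  obtain ⟨P, hP, -, h'⟩ := T.exists_mem_support_quotient_prime j N hq
  exact Module.notMem_support_of_subsingleton (h P hP) h'

end Noetherian

section Local

variable [IsLocalRing R]

lemma subsingleton_of_closedPoint_notMem {X : Type*} [AddCommGroup X] [Module R X]
    [Module.Finite R X] (h : IsLocalRing.closedPoint R ∉ Module.support R X) :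
    Subsingleton X := by
  by_contra hc
  have := not_subsingleton_iff_nontrivial.1 hc
  exact h (IsLocalRing.closedPoint_mem_support R X)

lemma le_closedPoint (P : PrimeSpectrum R) : P ≤ IsLocalRing.closedPoint R :=
  IsLocalRing.le_maximalIdeal P.2.ne_top

lemma exists_notMem_of_ne_closedPoint {P : PrimeSpectrum R} (h : P ≠ IsLocalRing.closedPoint R) :
    ∃ x ∈ IsLocalRing.maximalIdeal R, x ∉ P.asIdeal := by
  by_contra! hc
  exact h (le_antisymm (le_closedPoint P) hc)

variable [IsNoetherianRing R]
variable (hfin : ∀ (j : ℤ) (N : ModuleCat.{0} R), Module.Finite R N →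
    Module.Finite R (T.obj j N)) (t : ℤ)

include hfin

lemma subsingleton_quotient_prime (j : ℤ) {P : PrimeSpectrum R}
    (hP : P ≠ IsLocalRing.closedPoint R)
    (h : ∀ Q > P, Subsingleton (T.obj (j + 1) (ModuleCat.of R (R ⧸ Q.asIdeal)))) :
    Subsingleton (T.obj j (ModuleCat.of R (R ⧸ P.asIdeal))) := by
  obtain ⟨x, hxm, hx⟩ := exists_notMem_of_ne_closedPoint hP
  have := hfin j (ModuleCat.of R (R ⧸ P.asIdeal))
    (inferInstanceAs (Module.Finite R (R ⧸ P.asIdeal)))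
  refine subsingleton_of_closedPoint_notMem
    (T.notMem_support_of_quotSMulTop hfin j P _ hx hxm ?_)
  exact Module.notMem_support_of_subsingleton
    (T.subsingleton_of_forall_prime (j + 1) (QuotSMulTop x (R ⧸ P.asIdeal))
      fun Q hQ ↦ h Q (lt_of_mem_support_quotSMulTop hx hQ))

/-- If `T^j` vanishes on the residue field for `j > t`, it vanishes on all finitely generated
modules for `j > t`. -/
theorem subsingleton_of_gt
    (hk : ∀ j, t < j → Subsingleton (T.obj j (ModuleCat.of R
      (R ⧸ IsLocalRing.maximalIdeal R))))
    (j : ℤ) (hj : t < j) (N : Type) [AddCommGroup N] [Module R N] [Module.Finite R N] :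
    Subsingleton (T.obj j (ModuleCat.of R N)) := by
  suffices H : ∀ (P : PrimeSpectrum R) (j : ℤ), t < j →
      Subsingleton (T.obj j (ModuleCat.of R (R ⧸ P.asIdeal))) from
    T.subsingleton_of_forall_prime j N fun P _ ↦ H P j hj
  intro P
  induction P using (PrimeSpectrum.wellFoundedGT R).wf.induction with
  | _ P ih =>
    intro j hj
    by_cases hP : P = IsLocalRing.closedPoint R
    · subst hP
      exact hk j hj
    · exact T.subsingleton_quotient_prime hfin j hP fun Q hQ ↦ ih Q hQ (j + 1) (by lia)

/-- If `T^j` vanishes on the residue field for `j < t`, then `T^j(R/P)` vanishes for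
`j < t - dim R/P`. -/
theorem subsingleton_quotient_prime_of_lt
    (hk : ∀ j, j < t → Subsingleton (T.obj j (ModuleCat.of R
      (R ⧸ IsLocalRing.maximalIdeal R))))
    (n : ℕ) (P : PrimeSpectrum R) (hP : Order.coheight P ≤ n) (j : ℤ) (hj : j < t - n) :
    Subsingleton (T.obj j (ModuleCat.of R (R ⧸ P.asIdeal))) := by
  induction n generalizing P j with
  | zero =>
    have : P = IsLocalRing.closedPoint R :=
      ((Order.coheight_eq_zero.1 (by simpa using hP)).eq_of_le
        (le_closedPoint P))
    subst this
    exact hk j (by simpa using hj)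
  | succ n ih =>
    by_cases hP' : P = IsLocalRing.closedPoint R
    · subst hP'
      exact hk j (by lia)
    · refine T.subsingleton_quotient_prime hfin j hP' fun Q hQ ↦ ih Q ?_ (j + 1) ?_
      · have := (Order.coheight_le_coe_iff.1 hP) Q hQ
        exact Order.le_of_lt_add_one (by simpa using this)
      · push_cast at hj; lia

/-- If `T^j` vanishes on the residue field exactly for `j ≠ t`, then `P` lies in the support of
`T^j(R/P)` for `j = t - dim R/P` but for no larger `j`. -/
theorem mem_support_quotient_prime
    (hk : ∀ j, j ≠ t → Subsingleton (T.obj j (ModuleCat.of R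
      (R ⧸ IsLocalRing.maximalIdeal R))))
    (hkt : Nontrivial (T.obj t (ModuleCat.of R (R ⧸ IsLocalRing.maximalIdeal R))))
    (n : ℕ) (P : PrimeSpectrum R) (hP : Order.coheight P = n) :
    (∀ i, t - n < i → P ∉ Module.support R (T.obj i (ModuleCat.of R (R ⧸ P.asIdeal)))) ∧
      P ∈ Module.support R (T.obj (t - n) (ModuleCat.of R (R ⧸ P.asIdeal))) := by
  have hB := T.subsingleton_quotient_prime_of_lt hfin t (fun j hj ↦ hk j hj.ne)
  induction n generalizing P with
  | zero =>
    have : P = IsLocalRing.closedPoint R :=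
      ((Order.coheight_eq_zero.1 (by simpa using hP)).eq_of_le
        (le_closedPoint P))
    subst this
    have := hfin t (ModuleCat.of R (R ⧸ IsLocalRing.maximalIdeal R))
      (inferInstanceAs (Module.Finite R (R ⧸ IsLocalRing.maximalIdeal R)))
    refine ⟨fun i hi ↦ ?_, ?_⟩
    · exact Module.notMem_support_of_subsingleton (hk i (by rintro rfl; simp at hi))
    · rw [show t - ((0 : ℕ) : ℤ) = t by simp]
      exact IsLocalRing.closedPoint_mem_support R (T.obj t (ModuleCat.of R
        (R ⧸ IsLocalRing.maximalIdeal R)))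
  | succ n ih =>
    obtain ⟨hfinht, ⟨q, hPq, hq⟩, hmax⟩ :=
      Order.coheight_eq_coe_add_one_iff.1 (by simpa using hP)
    obtain ⟨hqgt, hqmem⟩ := ih q hq
    obtain ⟨x, hxq, hxP⟩ : ∃ x ∈ q.asIdeal, x ∉ P.asIdeal :=
      SetLike.exists_of_lt (show P.asIdeal < q.asIdeal from hPq)
    have hgtq (i : ℤ) (hi : t - (n + 1 : ℕ) < i) :
        q ∉ Module.support R (T.obj i (ModuleCat.of R (R ⧸ P.asIdeal))) := by
      refine T.notMem_support_of_quotSMulTop hfin i P q hxP hxq fun hmem ↦ ?_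
      obtain ⟨Q, hQ, hQq, hQmem⟩ := T.exists_mem_support_quotient_prime (i + 1)
        (QuotSMulTop x (R ⧸ P.asIdeal)) hmem
      have hPQ := lt_of_mem_support_quotSMulTop hxP hQ
      rcases hQq.lt_or_eq with hlt | rfl
      · have h1 := Order.coheight_add_one_le hlt
        have h2 := hmax Q hPQ
        rw [hq] at h1
        exact absurd (h1.trans h2) (by norm_cast; lia)
      · exact hqgt (i + 1) (by push_cast at hi; lia) hQmem
    refine ⟨fun i hi hmem ↦ hgtq i hi (Module.mem_support_mono hPq.le hmem), ?_⟩
    -- below the critical degree everything vanishes on quotients of `R/P` by nonzero elements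
    have hvan (y : R) (hy : y ∉ P.asIdeal) (C : Type) [AddCommGroup C] [Module R C]
        [Module.Finite R C]
        (hC : Module.support R C ⊆ Module.support R (QuotSMulTop y (R ⧸ P.asIdeal))) :
        Subsingleton (T.obj (t - (n + 1 : ℕ)) (ModuleCat.of R C)) := by
      refine T.subsingleton_of_forall_prime _ C fun Q hQ ↦ hB n Q ?_ _ (by push_cast; lia)
      exact hmax Q (lt_of_mem_support_quotSMulTop hy (hC hQ))
    set K := T.obj (t - (n + 1 : ℕ)) (ModuleCat.of R (R ⧸ P.asIdeal)) with hK
    have : Module.Finite R K := hfin _ _ (inferInstanceAs (Module.Finite R (R ⧸ P.asIdeal)))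
    have hKne : Nontrivial K := by
      by_contra hKs
      rw [not_nontrivial_iff_subsingleton] at hKs
      set N := QuotSMulTop x (R ⧸ P.asIdeal)
      have hN : q ∉ Module.support R (T.obj (t - (n + 1 : ℕ) + 1) (ModuleCat.of R N)) := by
        intro hmem
        rcases Module.support_subset_union_of_exact
          (T.exact₃ (shortExact_smul_quotient_prime P hxP) (t - (n + 1 : ℕ))) hmem with h | h
        · exact Module.notMem_support_of_subsingleton (X := T.obj (t - (n + 1 : ℕ))
            (ModuleCat.of R (R ⧸ P.asIdeal))) hKs h
        · exact hgtq _ (by lia) h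
      obtain ⟨g, hg⟩ : ∃ g : N →ₗ[R] R ⧸ q.asIdeal, Function.Surjective g := by
        open scoped Pointwise in
        refine ⟨(x • (⊤ : Submodule R (R ⧸ P.asIdeal))).liftQ
          (Submodule.mapQ P.asIdeal q.asIdeal LinearMap.id hPq.le) ?_, ?_⟩
        · rintro _ ⟨z, -, rfl⟩
          obtain ⟨z, rfl⟩ := Submodule.Quotient.mk_surjective _ z
          change Submodule.Quotient.mk (x • z) = 0
          rw [Submodule.Quotient.mk_eq_zero]
          exact q.asIdeal.mul_mem_right z hxq
        · intro z
          obtain ⟨z, rfl⟩ := Submodule.Quotient.mk_surjective _ z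
          exact ⟨Submodule.Quotient.mk (Submodule.Quotient.mk z), rfl⟩
      have hS := LinearMap.shortExact_shortComplexKer hg
      have hker := hvan x hxP (LinearMap.ker g)
        (Module.support_subset_of_injective _ (LinearMap.ker g).injective_subtype)
      have hex := T.exact₃ hS (t - (n + 1 : ℕ))
      have hinj : Function.Injective (T.map (t - (n + 1 : ℕ) + 1)
          (LinearMap.shortComplexKer g).g) := by
        rw [injective_iff_map_eq_zero]
        intro z hz
        obtain ⟨w, rfl⟩ := (hex z).1 hz
        have : w = 0 := @Subsingleton.elim _ hker w 0
        rw [this, map_zero]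
      have heq : t - (n + 1 : ℕ) + 1 = t - n := by push_cast; lia
      refine hN (Module.support_subset_of_injective _ hinj ?_)
      rw [heq]
      exact hqmem
    rw [Module.mem_support_iff_of_finite]
    intro s hs
    by_contra hsP
    obtain ⟨z, hz⟩ := exists_ne (0 : K)
    have hS := shortExact_smul_quotient_prime P hsP
    have hsub := hvan s hsP (QuotSMulTop s (R ⧸ P.asIdeal)) subset_rfl
    have hex := T.exact₂ hS (t - (n + 1 : ℕ))
    obtain ⟨w, hw⟩ := (hex z).1 (by
      rw [ModuleCat.smulShortComplex_f_eq_smul_id]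
      exact (LinearMap.congr_fun (T.map_smul_id _ _ s) z).trans
        (Module.mem_annihilator.1 hs z))
    have : w = 0 := @Subsingleton.elim _ hsub w 0
    exact hz (by rw [← hw, this, map_zero]; rfl)

end Local

end CohomologicalFunctor

universe w

section

open Pretriangulated Opposite Pretriangulated.Opposite

/-- The linear map `Hom(A, X[j]) → Hom(Z, X[j + 1])` induced by a morphism `Z ⟶ A[1]`. -/
def precompConnecting {R : Type} [CommRing R] [HasDerivedCategory.{w} (ModuleCat.{0} R)]
    {A Z : DerivedCategory (ModuleCat.{0} R)} (h : Z ⟶ A⟦(1 : ℤ)⟧)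
    (X : DerivedCategory (ModuleCat.{0} R)) (j : ℤ) :
    (A ⟶ X⟦j⟧) →ₗ[R] (Z ⟶ X⟦j + 1⟧) where
  toFun z := h ≫ z⟦(1 : ℤ)⟧' ≫
    (shiftFunctorAdd' (DerivedCategory (ModuleCat.{0} R)) j 1 (j + 1) rfl).inv.app X
  map_add' a b := by
    rw [Functor.map_add, Preadditive.add_comp, Preadditive.comp_add]
  map_smul' r a := by
    rw [Functor.map_smul, Linear.smul_comp, Linear.comp_smul, RingHom.id_apply]

/-- The functor `N ↦ Hom(N, X[j])` in the derived category of `R`-modules. -/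
def derivedHom {R : Type} [CommRing R] [HasDerivedCategory.{w} (ModuleCat.{0} R)]
    (X : DerivedCategory (ModuleCat.{0} R)) : CohomologicalFunctor.{w} R where
  obj j N := ModuleCat.of R
    (ShiftedHom ((DerivedCategory.singleFunctor (ModuleCat.{0} R) 0).obj N) X j)
  map j N N' f :=
    { toFun := fun z ↦ (DerivedCategory.singleFunctor (ModuleCat.{0} R) 0).map f ≫ z
      map_add' := fun a b ↦ Preadditive.comp_add _ _ _ _ _ _
      map_smul' := fun r a ↦ Linear.comp_smul _ _ _ _ _ _ }
  map_comp j N N' N'' f g := by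
    ext z
    change (DerivedCategory.singleFunctor (ModuleCat.{0} R) 0).map (f ≫ g) ≫ z = _
    rw [Functor.map_comp, Category.assoc]
    rfl
  map_smul_id j N x := by
    ext z
    change (DerivedCategory.singleFunctor (ModuleCat.{0} R) 0).map (x • 𝟙 N) ≫ z = x • z
    rw [Functor.map_smul, Linear.smul_comp, CategoryTheory.Functor.map_id, Category.id_comp]
  δ {S} hS j := precompConnecting hS.singleTriangle.mor₃ X j
  exact₂ hS j := by
    have := (preadditiveYoneda.obj X).homologySequence_exact₂ _
      (op_distinguished _ hS.singleTriangle_distinguished) j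
    rw [ShortComplex.ab_exact_iff_function_exact] at this
    exact this
  exact₁ hS j := by
    have := (preadditiveYoneda.obj X).homologySequence_exact₃ _
      (op_distinguished _ hS.singleTriangle_distinguished) j (j + 1) rfl
    rw [ShortComplex.ab_exact_iff_function_exact] at this
    intro z
    refine Iff.trans ?_ (this z)
    exact iff_of_eq (congrArg (· = 0)
      (preadditiveYoneda_homologySequenceδ_apply hS.singleTriangle j (j + 1) rfl z).symm)
  exact₃ hS j := by
    have := (preadditiveYoneda.obj X).homologySequence_exact₁ _
      (op_distinguished _ hS.singleTriangle_distinguished) j (j + 1) rfl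
    rw [ShortComplex.ab_exact_iff_function_exact] at this
    intro z
    refine (this z).trans ?_
    constructor
    all_goals
      rintro ⟨w, hw⟩
      refine ⟨w, ?_⟩
      rw [← hw]
    · exact (preadditiveYoneda_homologySequenceδ_apply hS.singleTriangle j (j + 1) rfl w).symm
    · exact (preadditiveYoneda_homologySequenceδ_apply hS.singleTriangle j (j + 1) rfl w)

end

section

variable {R : Type} [CommRing R] [HasDerivedCategory.{w} (ModuleCat.{0} R)]

/-- The morphism in the derived category represented by a cocycle of the Hom-complex. -/
def cocycleToDerived (F N : Cx R) (j : ℤ) :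
    Cocycle F N j →ₗ[R] (DerivedCategory.Q.obj F ⟶ (DerivedCategory.Q.obj N)⟦j⟧) where
  toFun z := DerivedCategory.Q.map (Cocycle.equivHomShift.symm z) ≫
    (DerivedCategory.Q.commShiftIso j).hom.app N
  map_add' a b := by
    rw [map_add, Functor.map_add, Preadditive.add_comp]
  map_smul' r a := by
    have : Cocycle.equivHomShift.symm (r • a) = r • Cocycle.equivHomShift.symm a := by
      apply (Cocycle.equivHom _ _).injective
      ext p
      simp [Cocycle.equivHomShift_symm_apply, Cochain.rightShift_v _ _ _ _ _ _ _ _ rfl]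
    rw [this, Functor.map_smul, Linear.smul_comp, RingHom.id_apply]

lemma cocycleToDerived_eq (F N : Cx R) (j : ℤ) (z : Cocycle F N j) :
    cocycleToDerived F N j z = (DerivedCategory.quotientCompQhIso _).inv.app F ≫
      DerivedCategory.Qh.map (CohomologyClass.toHom (CohomologyClass.mk z)) ≫
      (DerivedCategory.quotientCompQhIso _).hom.app (N⟦j⟧) ≫
      (DerivedCategory.Q.commShiftIso j).hom.app N := by
  rw [CohomologyClass.toHom_mk, DerivedCategory.quotientCompQhIso_hom_naturality_assoc,
    Iso.inv_hom_id_app_assoc]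
  rfl

lemma cocycleToDerived_eq_zero_iff (F N : Cx R) [F.IsKProjective] (j : ℤ) (z : Cocycle F N j) :
    cocycleToDerived F N j z = 0 ↔ z ∈ CochainComplex.HomComplex.coboundaries F N j := by
  rw [← CohomologyClass.toHom_mk_eq_zero_iff, cocycleToDerived_eq]
  constructor
  · intro h
    rw [Preadditive.IsIso.comp_left_eq_zero, Preadditive.IsIso.comp_right_eq_zero] at h
    exact (CochainComplex.IsKProjective.Qh_map_bijective F _).injective
      (h.trans (Functor.map_zero _ _ _).symm)
  · intro h
    rw [h, Functor.map_zero, zero_comp, comp_zero]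

lemma cocycleToDerived_surjective (F N : Cx R) [F.IsKProjective] (j : ℤ) :
    Function.Surjective (cocycleToDerived F N j) := by
  intro f
  obtain ⟨g, hg⟩ := (CochainComplex.IsKProjective.Qh_map_bijective F _).surjective
    ((DerivedCategory.quotientCompQhIso _).hom.app F ≫ f ≫
      (DerivedCategory.Q.commShiftIso j).inv.app N ≫
      (DerivedCategory.quotientCompQhIso _).inv.app (N⟦j⟧))
  obtain ⟨y, rfl⟩ := (CohomologyClass.toHom_bijective F N j).surjective g
  obtain ⟨z, rfl⟩ := y.mk_surjective
  refine ⟨z, ?_⟩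
  rw [cocycleToDerived_eq, hg]
  simp

/-- The comparison of the hyper-Ext module with morphisms in the derived category. -/
def extModuleEquiv (F N : Cx R) [F.IsKProjective] (j : ℤ) :
    extModule R F N j ≃ₗ[R] (DerivedCategory.Q.obj F ⟶ (DerivedCategory.Q.obj N)⟦j⟧) :=
  let g : ↥(LinearMap.ker (δ_hom R F N j (j + 1))) →ₗ[R] Cocycle F N j :=
    { toFun := fun z ↦ Cocycle.mk z.1 (j + 1) rfl z.2
      map_add' := fun _ _ ↦ rfl
      map_smul' := fun _ _ ↦ rfl }
  (Submodule.quotEquivOfEq _ (LinearMap.ker (cocycleToDerived F N j ∘ₗ g)) (by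
    ext z
    rw [LinearMap.mem_ker, LinearMap.comp_apply, cocycleToDerived_eq_zero_iff,
      mem_coboundaries_iff _ (j - 1) (by simp)]
    rfl)).trans
  (LinearMap.quotKerEquivOfSurjective _ (fun f ↦ by
    obtain ⟨z, rfl⟩ := cocycleToDerived_surjective F N j f
    exact ⟨⟨z.1, z.δ_eq_zero (j + 1)⟩, rfl⟩))
end

section

variable {R : Type} [CommRing R]

lemma isKProjective_of_bounded {F : Cx R} (h : ∀ n : ℤ, Projective (F.X n))
    (hb : ∃ b : ℤ, ∀ n : ℤ, b ≤ n → IsZero (F.X n)) : F.IsKProjective := by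
  obtain ⟨b, hb⟩ := hb
  have : F.IsStrictlyLE b := by
    rw [CochainComplex.isStrictlyLE_iff]
    intro i hi
    exact hb i hi.le
  exact CochainComplex.isKProjective_of_projective F b

lemma exists_isSemiprojResolution_single (N : ModuleCat.{0} R) :
    ∃ (F : Cx R) (π : F ⟶ sgl N), IsSemiprojResolution π := by
  let P := projectiveResolution N
  refine ⟨P.cochainComplex, P.π', ?_, ⟨1, fun n hn ↦ ?_⟩, ?_⟩
  · intro n
    infer_instance
  · exact CochainComplex.isZero_of_isStrictlyLE _ 0 n (by lia)
  · have : QuasiIso (P.π' : _ ⟶ (CochainComplex.singleFunctor (ModuleCat.{0} R) 0).obj N) :=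
      inferInstance
    exact this

end

section

variable {R : Type} [CommRing R]

lemma ofHom_toSpanSingleton_comp_d (D : Cx R) (j : ℤ) {x : D.X j}
    (hx : (D.d j (j + 1)).hom x = 0) :
    ModuleCat.ofHom (LinearMap.toSpanSingleton R (D.X j) x) ≫ D.d j (j + 1) = 0 := by
  ext
  change (D.d j (j + 1)).hom ((1 : R) • x) = 0
  rw [one_smul, hx]

/-- Cycles of degree `j` as cocycles on the complex `R`. -/
def cyclesToCocycle (D : Cx R) (j : ℤ) : LinearMap.ker (D.d j (j + 1)).hom →ₗ[R]
    Cocycle ((CochainComplex.singleFunctor (ModuleCat.{0} R) 0).obj (ModuleCat.of R R)) D j where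
  toFun x := Cocycle.fromSingleMk (ModuleCat.ofHom (LinearMap.toSpanSingleton R (D.X j) x.1))
    (zero_add j) (j + 1) rfl (ofHom_toSpanSingleton_comp_d D j (LinearMap.mem_ker.1 x.2))
  map_add' x y := by
    rw [← Cocycle.fromSingleMk_add]
    congr 1
    ext
    exact smul_add (1 : R) _ _
  map_smul' r x := by
    ext : 1
    apply (Cochain.fromSingleEquiv (zero_add j)).injective
    have h := Linear.comp_smul _ _ _
      (HomologicalComplex.singleObjXSelf (ComplexShape.up ℤ) 0 (ModuleCat.of R R)).inv r
      ((HomologicalComplex.singleObjXSelf (ComplexShape.up ℤ) 0 (ModuleCat.of R R)).hom ≫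
        ModuleCat.ofHom (LinearMap.toSpanSingleton R (D.X j) x.1))
    rw [Iso.inv_hom_id_assoc] at h
    refine Eq.trans ?_ (h.symm.trans ?_)
    · ext
      simp [Cochain.fromSingleEquiv]
    · simp [Cochain.fromSingleEquiv]
      rfl

lemma cyclesToCocycle_surjective (D : Cx R) (j : ℤ) :
    Function.Surjective (cyclesToCocycle D j) := by
  intro z
  obtain ⟨f, hf, rfl⟩ := Cocycle.fromSingleMk_surjective z j (zero_add j) (j + 1) rfl
  have h : (D.d j (j + 1)).hom (f.hom (1 : R)) = 0 := by
    change (f ≫ D.d j (j + 1)).hom (1 : R) = 0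
    rw [hf]
    rfl
  refine ⟨⟨f.hom (1 : R), LinearMap.mem_ker.2 h⟩, ?_⟩
  have : ModuleCat.ofHom (LinearMap.toSpanSingleton R (D.X j) (f.hom (1 : R))) = f := by
    ext
    exact one_smul R _
  change Cocycle.fromSingleMk (ModuleCat.ofHom
    (LinearMap.toSpanSingleton R (D.X j) (f.hom (1 : R)))) (zero_add j) (j + 1) rfl
    (ofHom_toSpanSingleton_comp_d D j h) = _
  simp only [this]

lemma cyclesToCocycle_mem_coboundaries_iff (D : Cx R) (j : ℤ)
    (x : LinearMap.ker (D.d j (j + 1)).hom) :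
    cyclesToCocycle D j x ∈ CochainComplex.HomComplex.coboundaries _ _ _ ↔
      x.1 ∈ LinearMap.range (D.d (j - 1) j).hom := by
  refine (Cocycle.fromSingleMk_mem_coboundaries_iff _ _ (j + 1) rfl
    (ofHom_toSpanSingleton_comp_d D j (LinearMap.mem_ker.1 x.2)) (j - 1) (by lia)).trans ?_
  constructor
  · rintro ⟨g, hg⟩
    refine ⟨g.hom (1 : R), ?_⟩
    change (g ≫ D.d (j - 1) j).hom (1 : R) = x.1
    rw [hg]
    exact one_smul R _
  · rintro ⟨y, hy⟩
    refine ⟨ModuleCat.ofHom (LinearMap.toSpanSingleton R _ y), ?_⟩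
    ext
    change (D.d (j - 1) j).hom ((1 : R) • y) = (1 : R) • x.1
    rw [one_smul, one_smul, hy]

instance : (sgl (ModuleCat.of R R)).IsKProjective := by
  apply isKProjective_of_bounded
  · intro n
    by_cases hn : n = 0
    · subst hn
      exact Projective.of_iso (HomologicalComplex.singleObjXSelf (.up ℤ) 0 (ModuleCat.of R R)).symm
        inferInstance
    · exact (HomologicalComplex.isZero_single_obj_X _ _ _ _ hn).projective
  · exact ⟨1, fun n hn ↦ HomologicalComplex.isZero_single_obj_X _ _ _ _ (by lia)⟩

variable [HasDerivedCategory.{w} (ModuleCat.{0} R)]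

/-- Morphisms from `R` in the derived category compute the cohomology. -/
def derivedHomRingEquiv (D : Cx R) (j : ℤ) :
    (DerivedCategory.Q.obj (sgl (ModuleCat.of R R)) ⟶ (DerivedCategory.Q.obj D)⟦j⟧) ≃ₗ[R]
      D.homology j := by
  let S := D.sc' (j - 1) j (j + 1)
  let g : LinearMap.ker S.g.hom →ₗ[R] (DerivedCategory.Q.obj (sgl (ModuleCat.of R R)) ⟶
      (DerivedCategory.Q.obj D)⟦j⟧) :=
    cocycleToDerived (sgl (ModuleCat.of R R)) D j ∘ₗ cyclesToCocycle D j
  have hg : Function.Surjective g :=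
    (cocycleToDerived_surjective _ _ _).comp (cyclesToCocycle_surjective D j)
  have hk : LinearMap.range S.moduleCatToCycles = LinearMap.ker g := by
    ext x
    refine Iff.trans ?_ (((cocycleToDerived_eq_zero_iff (sgl (ModuleCat.of R R)) _ _ _).trans
      (cyclesToCocycle_mem_coboundaries_iff D j x)).symm.trans LinearMap.mem_ker.symm)
    constructor
    · rintro ⟨y, rfl⟩
      exact ⟨y, rfl⟩
    · rintro ⟨y, hy⟩
      exact ⟨y, Subtype.ext hy⟩
  have e : D.homology j ≅ S.homology :=
    ShortComplex.homologyMapIso (D.isoSc' (j - 1) j (j + 1) (by simp) (by simp))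
  exact ((e ≪≫ S.moduleCatHomologyIso).toLinearEquiv.trans
    ((Submodule.quotEquivOfEq _ _ hk).trans (LinearMap.quotKerEquivOfSurjective g hg))).symm
end

/-- The short exact sequence of module categories attached to an exact sequence of modules. -/
lemma shortExact_of_exact {R : Type} [CommRing R] {N₁ N₂ N₃ : Type}
    [AddCommGroup N₁] [AddCommGroup N₂] [AddCommGroup N₃] [Module R N₁] [Module R N₂] [Module R N₃]
    {f : N₁ →ₗ[R] N₂} {g : N₂ →ₗ[R] N₃} (hf : Function.Injective f) (hg : Function.Surjective g)
    (hfg : Function.Exact f g) :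
    (ModuleCat.shortComplexOfCompEqZero f g hfg.linearMap_comp_eq_zero).ShortExact :=
  { exact := ModuleCat.shortComplex_exact _ hfg
    mono_f := (ModuleCat.mono_iff_injective _).2 hf
    epi_g := (ModuleCat.epi_iff_surjective _).2 hg }

/-- The short exact sequence `0 → N' → N → N/N' → 0`. -/
lemma shortExact_submodule {R : Type} [CommRing R] {N : Type} [AddCommGroup N] [Module R N]
    (N' : Submodule R N) :
    (ModuleCat.shortComplexOfCompEqZero N'.subtype N'.mkQ
      (LinearMap.exact_subtype_mkQ N').linearMap_comp_eq_zero).ShortExact :=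
  shortExact_of_exact N'.injective_subtype N'.mkQ_surjective (LinearMap.exact_subtype_mkQ N')

lemma ModuleCat.isZero_of_equiv {R : Type} [CommRing R]
    {M : ModuleCat.{0} R} {N : ModuleCat.{w} R} (e : N ≃ₗ[R] M) :
    IsZero M ↔ Subsingleton N := by
  rw [ModuleCat.isZero_iff_subsingleton]
  exact e.symm.toEquiv.subsingleton_congr

lemma Module.Finite.of_exact_of_noetherian {R A B C : Type*} [CommRing R] [IsNoetherianRing R]
    [AddCommGroup A] [AddCommGroup B] [AddCommGroup C] [Module R A] [Module R B] [Module R C]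
    [Module.Finite R A] [Module.Finite R C] {f : A →ₗ[R] B} {g : B →ₗ[R] C}
    (h : Function.Exact f g) : Module.Finite R B := by
  have : IsNoetherian R A := isNoetherian_of_isNoetherianRing_of_finite R A
  have : IsNoetherian R C := isNoetherian_of_isNoetherianRing_of_finite R C
  have : IsNoetherian R B := isNoetherian_of_range_eq_ker f g (LinearMap.exact_iff.1 h).symm
  infer_instance

namespace CohomologicalFunctor

variable {R : Type} [CommRing R] [IsNoetherianRing R]

/-- A cohomological functor which vanishes in low degrees and is finite on `R` is finite on
finite modules. -/
lemma finite_obj (T : CohomologicalFunctor R) (a : ℤ)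
    (h0 : ∀ j < a, ∀ N : ModuleCat.{0} R, Subsingleton (T.obj j N))
    (hR : ∀ j, Module.Finite R (T.obj j (ModuleCat.of R R))) (j : ℤ) (N : ModuleCat.{0} R)
    (hN : Module.Finite R N) : Module.Finite R (T.obj j N) := by
  suffices ∀ (n : ℕ) (j : ℤ), j < a + n → ∀ (N : Type) [AddCommGroup N] [Module R N]
      [Module.Finite R N], Module.Finite R (T.obj j (ModuleCat.of R N)) from
    this (j - a + 1).toNat j (by lia) N
  intro n
  induction n with
  | zero =>
    intro j hj N _ _ _
    have := h0 j (by simpa using hj) (ModuleCat.of R N)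
    infer_instance
  | succ n ih =>
    intro j hj N _ _ hN
    induction hN using IsNoetherianRing.induction_on_isQuotientEquivQuotientPrime R with
    | subsingleton N =>
      have := T.subsingleton_obj j (N := ModuleCat.of R N)
      infer_instance
    | quotient N p f =>
      have hS := shortExact_submodule (R := R) p.asIdeal
      obtain ⟨i, rfl⟩ : ∃ i, j = i + 1 := ⟨j - 1, by lia⟩
      have h1 := ih i (by push_cast at hj; lia) p.asIdeal
      have h2 := hR (i + 1)
      have : Module.Finite R (T.obj (i + 1) (ModuleCat.of R (R ⧸ p.asIdeal))) :=
        Module.Finite.of_exact_of_noetherian (T.exact₃ hS i)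
      exact Module.Finite.equiv (T.mapEquiv (i + 1) f.toModuleIso)
    | exact N₁ N₂ N₃ f g hf hg hfg h₁ h₃ =>
      have := h₁
      have := h₃
      exact Module.Finite.of_exact_of_noetherian (T.exact₂ (shortExact_of_exact hf hg hfg) j)

end CohomologicalFunctor

section

open DerivedCategory Pretriangulated

variable {R : Type} [CommRing R] [HasDerivedCategory.{w} (ModuleCat.{0} R)]

lemma subsingleton_hom_shift_of_isLE_of_isGE {A X : DerivedCategory (ModuleCat.{0} R)} (b a : ℤ)
    [A.IsLE b] [X.IsGE a] {j : ℤ} (hj : j < a - b) : Subsingleton (A ⟶ X⟦j⟧) := by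
  have : (X⟦j⟧).IsGE (a - j) := TStructure.t.isGE_shift X a j (a - j)
  exact ⟨fun f g ↦ (TStructure.t.zero f b (a - j)).trans (TStructure.t.zero g b (a - j)).symm⟩

lemma subsingleton_derivedHom_of_isGE (X : DerivedCategory (ModuleCat.{0} R)) (a : ℤ) [X.IsGE a]
    {j : ℤ} (hj : j < a) (N : ModuleCat.{0} R) : Subsingleton ((derivedHom X).obj j N) :=
  subsingleton_hom_shift_of_isLE_of_isGE 0 a (by simpa using hj)

/-- The isomorphism of `T^j(N)` induced by an isomorphism of coefficients. -/
def derivedHomEquivOfIso {X Y : DerivedCategory (ModuleCat.{0} R)} (e : X ≅ Y) (j : ℤ)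
    (N : ModuleCat.{0} R) : (derivedHom X).obj j N ≃ₗ[R] (derivedHom Y).obj j N :=
  Linear.homCongr R (Iso.refl _) ((shiftFunctor _ j).mapIso e)

/-- `T^j(R)` is the cohomology of the coefficients. -/
def derivedHomRingIso (D : Cx R) (j : ℤ) :
    (derivedHom (Q.obj D)).obj j (ModuleCat.of R R) ≃ₗ[R] D.homology j :=
  derivedHomRingEquiv D j

lemma isGE_iff_subsingleton (X : DerivedCategory (ModuleCat.{0} R)) (n : ℤ) :
    X.IsGE n ↔ ∀ i < n, Subsingleton ((derivedHom X).obj i (ModuleCat.of R R)) := by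
  obtain ⟨K, ⟨e⟩⟩ : ∃ K, Nonempty (Q.obj K ≅ X) := ⟨_, ⟨Q.objObjPreimageIso X⟩⟩
  have h : X.IsGE n ↔ (Q.obj K).IsGE n :=
    ⟨fun _ ↦ TStructure.t.isGE_of_iso e.symm n, fun _ ↦ TStructure.t.isGE_of_iso e n⟩
  rw [h, isGE_Q_obj_iff, CochainComplex.isGE_iff]
  refine forall₂_congr fun i _ ↦ ?_
  rw [HomologicalComplex.exactAt_iff_isZero_homology]
  exact ModuleCat.isZero_of_equiv
    ((derivedHomEquivOfIso e i _).symm.trans (derivedHomRingIso K i))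

lemma isLE_iff_subsingleton (X : DerivedCategory (ModuleCat.{0} R)) (n : ℤ) :
    X.IsLE n ↔ ∀ i, n < i → Subsingleton ((derivedHom X).obj i (ModuleCat.of R R)) := by
  obtain ⟨K, ⟨e⟩⟩ : ∃ K, Nonempty (Q.obj K ≅ X) := ⟨_, ⟨Q.objObjPreimageIso X⟩⟩
  have h : X.IsLE n ↔ (Q.obj K).IsLE n :=
    ⟨fun _ ↦ TStructure.t.isLE_of_iso e.symm n, fun _ ↦ TStructure.t.isLE_of_iso e n⟩
  rw [h, isLE_Q_obj_iff, CochainComplex.isLE_iff]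
  refine forall₂_congr fun i _ ↦ ?_
  rw [HomologicalComplex.exactAt_iff_isZero_homology]
  exact ModuleCat.isZero_of_equiv
    ((derivedHomEquivOfIso e i _).symm.trans (derivedHomRingIso K i))

end

section

variable {R : Type} [CommRing R]

lemma isZero_ext_succ_iff (X Y : ModuleCat.{0} R) (i : ℕ) :
    IsZero (((Ext R (ModuleCat.{0} R) (i + 1)).obj (Opposite.op X)).obj Y) ↔
      Subsingleton (Abelian.Ext.{0} X Y (i + 1)) := by
  let P := ProjectiveResolution.of X
  rw [(P.isoExt (R := R) (i + 1) Y).isZero_iff, ← HomologicalComplex.exactAt_iff_isZero_homology,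
    HomologicalComplex.exactAt_iff' _ i (i + 1) (i + 1 + 1) (by simp) (by simp),
    ShortComplex.moduleCat_exact_iff]
  have key : Subsingleton (Abelian.Ext.{0} X Y (i + 1)) ↔
      ∀ (f : P.complex.X (i + 1) ⟶ Y), P.complex.d (i + 1 + 1) (i + 1) ≫ f = 0 →
        ∃ g : P.complex.X i ⟶ Y, P.complex.d (i + 1) i ≫ g = f := by
    constructor
    · intro _ f hf
      exact (P.extMk_eq_zero_iff f (i + 1 + 1) rfl hf i rfl).1 (Subsingleton.elim _ _)
    · refine fun h ↦ subsingleton_of_forall_eq 0 fun e ↦ ?_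
      obtain ⟨f, hf, rfl⟩ := P.extMk_surjective e (i + 1 + 1) rfl
      exact (P.extMk_eq_zero_iff f (i + 1 + 1) rfl hf i rfl).2 (h f hf)
  exact key.symm

variable [HasDerivedCategory.{w} (ModuleCat.{0} R)]

/-- The functors `Ext^j(-, M)`, extended by zero to negative `j`. -/
abbrev extFunctor (M : ModuleCat.{0} R) : CohomologicalFunctor.{w} R :=
  derivedHom ((DerivedCategory.singleFunctor (ModuleCat.{0} R) 0).obj M)

def extFunctorEquiv (N M : ModuleCat.{0} R) (n : ℕ) :
    Abelian.Ext.{0} N M n ≃ₗ[R] (extFunctor M).obj (n : ℤ) N :=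
  Abelian.Ext.homLinearEquiv

lemma subsingleton_extFunctor_of_projective (N M : ModuleCat.{0} R) [Projective N] (j : ℤ)
    (hj : 1 ≤ j) : Subsingleton ((extFunctor M).obj j N) := by
  obtain ⟨n, rfl⟩ : ∃ n : ℕ, j = ((n + 1 : ℕ) : ℤ) := ⟨(j - 1).toNat, by lia⟩
  have : Subsingleton (Abelian.Ext.{0} N M (n + 1)) :=
    subsingleton_of_forall_eq 0 fun e ↦ e.eq_zero_of_projective
  exact (extFunctorEquiv N M (n + 1)).symm.toEquiv.subsingleton

lemma subsingleton_extFunctor_of_neg (N M : ModuleCat.{0} R) (j : ℤ)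
    (hj : j < 0) : Subsingleton ((extFunctor M).obj j N) :=
  subsingleton_derivedHom_of_isGE _ 0 hj N

/-- The identification `Hom(N, M) = Ext^0(N, M)`. -/
def extFunctorZero (N M : ModuleCat.{0} R) : (N →ₗ[R] M) ≃ₗ[R] (extFunctor M).obj 0 N :=
  LinearEquiv.ofBijective
    { toFun := fun f ↦ ShiftedHom.mk₀ (0 : ℤ) rfl
        ((DerivedCategory.singleFunctor (ModuleCat.{0} R) 0).map (ModuleCat.ofHom f))
      map_add' := fun f g ↦ by
        rw [ModuleCat.ofHom_add, Functor.map_add]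
        exact ShiftedHom.mk₀_add _ _ _ _
      map_smul' := fun r f ↦ by
        have : ModuleCat.ofHom (r • f) = r • ModuleCat.ofHom f := rfl
        rw [this, Functor.map_smul]
        exact ShiftedHom.mk₀_smul _ _ _ }
    (by
      refine (ShiftedHom.homEquiv (0 : ℤ) rfl).bijective.comp ?_
      refine (Functor.FullyFaithful.ofFullyFaithful
        (DerivedCategory.singleFunctor (ModuleCat.{0} R) 0)).homEquiv.bijective.comp ?_
      exact (ModuleCat.homLinearEquiv (S := R)).symm.bijective)

lemma extFunctor_map_extFunctorZero {N N' M : ModuleCat.{0} R} (g : N ⟶ N') (f : N' →ₗ[R] M) :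
    (extFunctor M).map 0 g (extFunctorZero N' M f) = extFunctorZero N M (f ∘ₗ g.hom) := by
  change (DerivedCategory.singleFunctor _ 0).map g ≫ ShiftedHom.mk₀ (0 : ℤ) rfl
        ((DerivedCategory.singleFunctor (ModuleCat.{0} R) 0).map (ModuleCat.ofHom f)) =
     ShiftedHom.mk₀ (0 : ℤ) rfl
        ((DerivedCategory.singleFunctor (ModuleCat.{0} R) 0).map (g ≫ ModuleCat.ofHom f))
  rw [Functor.map_comp, ShiftedHom.mk₀, ShiftedHom.mk₀, Category.assoc]
end

lemma CochainComplex.quasiIso_opEquivalence_inverse_map {C : Type*} [Category* C] [Abelian C]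
    {A B : CochainComplex Cᵒᵖ ℤ} (f : A ⟶ B) [QuasiIso f] :
    QuasiIso ((CochainComplex.opEquivalence C).inverse.map f).unop := by
  rw [quasiIso_iff]
  intro n
  have h : QuasiIsoAt f (-n) := inferInstance
  rw [quasiIsoAt_iff' f (-(n + 1)) (-n) (-(n - 1)) (by grind [prev]) (by grind [next])] at h
  rw [quasiIsoAt_iff' _ (n - 1) n (n + 1) (by simp) (by simp), ← ShortComplex.quasiIso_opMap_iff]
  exact h

lemma exists_isSemiprojResolution {R : Type} [CommRing R] (D : Cx.{0} R)
    (hD : ∀ n : ℤ, 0 < n → IsZero (D.homology n)) :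
    ∃ (F : Cx R) (π : F ⟶ D), IsSemiprojResolution π := by
  have hLE : D.IsLE 0 := by
    rw [CochainComplex.isLE_iff]
    intro i hi
    rw [HomologicalComplex.exactAt_iff_isZero_homology]
    exact hD i hi
  have : QuasiIso (D.ιTruncLE 0) := by rwa [D.quasiIso_ιTruncLE_iff 0]
  suffices ∃ (F : Cx R) (π : F ⟶ D.truncLE 0), IsSemiprojResolution π by
    obtain ⟨F, π, h1, h2, h3⟩ := this
    exact ⟨F, π ≫ D.ιTruncLE 0, h1, h2, inferInstance⟩
  have : (D.truncLE 0).IsStrictlyLE 0 := inferInstance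
  generalize D.truncLE 0 = K at this ⊢
  let E := CochainComplex.opEquivalence (ModuleCat.{0} R)
  have : (E.functor.obj (Opposite.op K)).IsStrictlyGE 0 := by
    rw [CochainComplex.isStrictlyGE_iff]
    intro i hi
    exact (K.isZero_of_isStrictlyLE 0 (-i) (by lia)).op
  obtain ⟨L, i, _, hL, _⟩ := CochainComplex.Plus.modelCategoryQuillen.exists_quasiIso_injective
    (E.functor.obj (Opposite.op K)) 0
  have := CochainComplex.quasiIso_opEquivalence_inverse_map i
  refine ⟨(E.inverse.obj L).unop, (E.inverse.map i).unop ≫ (E.unitIso.app (Opposite.op K)).hom.unop,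
    fun n ↦ ?_, ⟨1, fun n hn ↦ ?_⟩, inferInstance⟩
  · have := hL (-n)
    exact (inferInstance : Projective (L.X (-n)).unop)
  · exact (L.isZero_of_isStrictlyGE 0 (-n) (by lia)).unop

lemma IsSemiprojResolution.isKProjective {R : Type} [CommRing R] {F M : Cx R} {π : F ⟶ M} (h : IsSemiprojResolution π) :
    F.IsKProjective := isKProjective_of_bounded h.1 h.2.1

section
open DerivedCategory
variable {R : Type} [CommRing R] [HasDerivedCategory.{w} (ModuleCat.{0} R)]

/-- The morphisms in the derived category computed from a semiprojective resolution. -/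
def IsSemiprojResolution.extModuleEquiv {F M : Cx R} {π : F ⟶ M} (h : IsSemiprojResolution π)
    (N : Cx R) (j : ℤ) : extModule R F N j ≃ₗ[R] (Q.obj M ⟶ (Q.obj N)⟦j⟧) :=
  have := h.isKProjective
  have := h.2.2
  (_root_.extModuleEquiv F N j).trans (Linear.homCongr R (asIso (Q.map π)) (Iso.refl _))

lemma subsingleton_hom_of_extVanishes {M N : Cx R} {j : ℤ} (h : ExtVanishes M N j)
    (hM : ∃ (F : Cx R) (π : F ⟶ M), IsSemiprojResolution π) :
    Subsingleton (Q.obj M ⟶ (Q.obj N)⟦j⟧) := by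
  obtain ⟨F, π, hπ⟩ := hM
  have : Subsingleton (extModule R F N j) := by
    rw [Submodule.Quotient.subsingleton_iff, eq_top_iff]
    rintro ⟨f, hf⟩ -
    obtain ⟨g, hg⟩ := h F π hπ f hf
    exact ⟨g, hg⟩
  exact (hπ.extModuleEquiv N j).symm.toEquiv.subsingleton
end

section
open DerivedCategory
variable {R : Type} [CommRing R] [IsLocalRing R]

namespace IsNormalizedDualizingComplex
variable {D : Cx R} (hD : IsNormalizedDualizingComplex R D)
  [HasDerivedCategory.{w} (ModuleCat.{0} R)]
include hD

lemma isLE : (Q.obj D).IsLE 0 := by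
  rw [isLE_iff_subsingleton]
  exact fun i hi ↦ (ModuleCat.isZero_of_equiv (derivedHomRingIso D i)).1 (hD.vanish_neg i hi)

lemma exists_isGE : ∃ a, (Q.obj D).IsGE a := by
  obtain ⟨a, ha⟩ := hD.homology_bounded
  refine ⟨a, ?_⟩
  rw [isGE_iff_subsingleton]
  exact fun i hi ↦ (ModuleCat.isZero_of_equiv (derivedHomRingIso D i)).1 (ha i hi)

lemma nontrivial : Nontrivial ((derivedHom (Q.obj D)).obj 0 (ModuleCat.of R R)) := by
  rw [← not_subsingleton_iff_nontrivial,
    ← ModuleCat.isZero_of_equiv (derivedHomRingIso D 0)]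
  exact hD.nonzero_zero

lemma finite_obj [IsNoetherianRing R] (j : ℤ) (N : ModuleCat.{0} R) (hN : Module.Finite R N) :
    Module.Finite R ((derivedHom (Q.obj D)).obj j N) := by
  obtain ⟨a, ha⟩ := hD.exists_isGE
  refine CohomologicalFunctor.finite_obj _ a
    (fun j hj N ↦ subsingleton_derivedHom_of_isGE _ a hj N) (fun j ↦ ?_) j N hN
  have := hD.finite_homology j
  exact Module.Finite.equiv (derivedHomRingIso D j).symm

lemma exists_residue : ∃ t : ℤ,
    (∀ j ≠ t, Subsingleton ((derivedHom (Q.obj D)).obj j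
      (ModuleCat.of R (R ⧸ IsLocalRing.maximalIdeal R)))) ∧
    Nonempty ((derivedHom (Q.obj D)).obj t
      (ModuleCat.of R (R ⧸ IsLocalRing.maximalIdeal R)) ≃ₗ[R] R ⧸ IsLocalRing.maximalIdeal R) := by
  obtain ⟨t, h1, h2⟩ := hD.ext_residue
  have hk := exists_isSemiprojResolution_single
    (ModuleCat.of R (R ⧸ IsLocalRing.maximalIdeal R))
  refine ⟨t, fun j hj ↦ subsingleton_hom_of_extVanishes (h2 j hj) hk, ?_⟩
  obtain ⟨F, π, hπ⟩ := hk
  obtain ⟨e⟩ := h1 F π hπ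
  exact ⟨(hπ.extModuleEquiv D t).symm.trans e⟩

end IsNormalizedDualizingComplex
end

lemma Function.Exact.subsingleton {R A B C : Type*} [Ring R] [AddCommGroup A] [AddCommGroup B]
    [AddCommGroup C] [Module R A] [Module R B] [Module R C] {f : A →ₗ[R] B} {g : B →ₗ[R] C}
    (h : Function.Exact f g) (hA : Subsingleton A) (hC : Subsingleton C) : Subsingleton B := by
  refine subsingleton_of_forall_eq 0 fun b ↦ ?_
  obtain ⟨a, rfl⟩ := (h b).1 (Subsingleton.elim _ _)
  rw [Subsingleton.elim a 0, map_zero]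

lemma Function.Exact.surjective_of_subsingleton {R A B C : Type*} [Ring R] [AddCommGroup A]
    [AddCommGroup B] [AddCommGroup C] [Module R A] [Module R B] [Module R C] {f : A →ₗ[R] B}
    {g : B →ₗ[R] C} (h : Function.Exact f g) (hC : Subsingleton C) : Function.Surjective f :=
  fun b ↦ (h b).1 (Subsingleton.elim _ _)

lemma Function.Exact.injective_of_subsingleton {R A B C : Type*} [Ring R] [AddCommGroup A]
    [AddCommGroup B] [AddCommGroup C] [Module R A] [Module R B] [Module R C] {f : A →ₗ[R] B}
    {g : B →ₗ[R] C} (h : Function.Exact f g) (hA : Subsingleton A) : Function.Injective g := by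
  refine (injective_iff_map_eq_zero g).2 fun b hb ↦ ?_
  obtain ⟨a, rfl⟩ := (h b).1 hb
  rw [Subsingleton.elim a 0, map_zero]

lemma ModuleCat.projective_self (R : Type) [CommRing R] : Projective (ModuleCat.of R R) :=
  (IsProjective.iff_projective (R := R) R).1 inferInstance

section
variable {R : Type} [CommRing R] [HasDerivedCategory.{w} (ModuleCat.{0} R)]

lemma exists_comp_eq_of_δ_eq_zero {M : ModuleCat.{0} R} {S : ShortComplex (ModuleCat.{0} R)}
    (hS : S.ShortExact) (f : S.X₁ →ₗ[R] M)
    (h : (extFunctor M).δ hS 0 (extFunctorZero _ _ f) = 0) :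
    ∃ g : S.X₂ →ₗ[R] M, g ∘ₗ S.f.hom = f := by
  obtain ⟨z, hz⟩ := ((extFunctor M).exact₁ hS 0 _).1 h
  obtain ⟨g, rfl⟩ := (extFunctorZero S.X₂ M).surjective z
  rw [extFunctor_map_extFunctorZero] at hz
  exact ⟨g, (extFunctorZero _ _).injective hz⟩

lemma finite_extFunctor [IsNoetherianRing R] (M : ModuleCat.{0} R) [Module.Finite R M] (j : ℤ)
    (N : ModuleCat.{0} R) (hN : Module.Finite R N) :
    Module.Finite R ((extFunctor M).obj j N) := by
  refine CohomologicalFunctor.finite_obj _ 0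
    (fun j hj N ↦ subsingleton_extFunctor_of_neg N M j hj) (fun j ↦ ?_) j N hN
  obtain hj | rfl | hj := lt_trichotomy j 0
  · have := subsingleton_extFunctor_of_neg (ModuleCat.of R R) M j hj
    infer_instance
  · exact Module.Finite.equiv ((LinearMap.ringLmapEquivSelf R R M).symm.trans
      (extFunctorZero (ModuleCat.of R R) M))
  · have := ModuleCat.projective_self R
    have := subsingleton_extFunctor_of_projective (ModuleCat.of R R) M j (by lia)
    infer_instance
end

lemma Module.Injective.of_finiteSelfInjDim (A : Type) [CommRing A] [IsNoetherianRing A]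
    [IsLocalRing A] (h : HasFiniteSelfInjDim A)
    (hA : IsLocalRing.maximalIdeal A ∈ associatedPrimes A A) : Module.Injective A A := by
  let _ := HasDerivedCategory.standard (ModuleCat.{0} A)
  let T := extFunctor (ModuleCat.of A A)
  have := ModuleCat.projective_self A
  have hvan (n : ℕ) (hn : ∀ j : ℤ, n < j → ∀ (N : Type) [AddCommGroup N] [Module A N]
        [Module.Finite A N], Subsingleton (T.obj j (ModuleCat.of A N))) :
      ∀ j : ℤ, 0 < j → ∀ (N : Type) [AddCommGroup N] [Module A N]
        [Module.Finite A N], Subsingleton (T.obj j (ModuleCat.of A N)) := by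
    induction n with
    | zero => exact hn
    | succ n ih =>
      refine ih fun j hj N _ _ _ ↦ CohomologicalFunctor.subsingleton_of_gt (T := T)
        (finite_extFunctor (ModuleCat.of A A)) n (fun i hi ↦ ?_) j hj N
      obtain ⟨-, f, hf⟩ := (isAssociatedPrime_iff_exists_injective_linearMap ..).1 hA
      exact (T.exact₁ (shortExact_of_exact hf (LinearMap.range f).mkQ_surjective
        (LinearMap.exact_map_mkQ_range f)) i).subsingleton
        (subsingleton_extFunctor_of_projective _ _ i (by lia)) (hn _ (by push_cast; lia) _)
  obtain ⟨n, hn⟩ := h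
  have hvan' := hvan n fun j hj N _ _ _ ↦ by
    obtain ⟨m, rfl⟩ : ∃ m : ℕ, j = ((m + 1 : ℕ) : ℤ) := ⟨(j - 1).toNat, by lia⟩
    have := (isZero_ext_succ_iff (ModuleCat.of A N) (ModuleCat.of A A) m).1
      (hn _ (m + 1) (by lia))
    exact (extFunctorEquiv (ModuleCat.of A N) (ModuleCat.of A A) (m + 1)).symm.toEquiv.subsingleton
  refine Module.Baer.injective fun I f ↦ ?_
  have := hvan' 1 (by lia) (A ⧸ I)
  obtain ⟨g, hg⟩ := exists_comp_eq_of_δ_eq_zero (M := ModuleCat.of A A) (shortExact_submodule I) f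
    (Subsingleton.elim (α := T.obj 1 (ModuleCat.of A (A ⧸ I))) _ _)
  exact ⟨g, fun x hx ↦ LinearMap.congr_fun hg ⟨x, hx⟩⟩

open TensorProduct in
lemma Module.Injective.of_flat (R A : Type) [CommRing R] [CommRing A] [Algebra R A]
    [Module.Flat R A] (M : Type) [AddCommGroup M] [Module R M] [Module A M] [IsScalarTower R A M]
    [Module.Injective A M] : Module.Injective R M where
  out X Y _ _ _ _ f hf g := by
    obtain ⟨h, hh⟩ := Module.Injective.out (R := A) (Q := M) (f.baseChange A)
      (Module.Flat.lTensor_preserves_injective_linearMap f hf) (g.liftBaseChange A)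
    refine ⟨h.restrictScalars R ∘ₗ TensorProduct.mk R A Y 1, fun x ↦ ?_⟩
    have := hh (1 ⊗ₜ x)
    simpa using this

lemma Module.Injective.localization_of_generically {R : Type} [CommRing R]
    (hgen : IsGenericallyGorenstein R) (p : Ideal R) [hp : p.IsPrime]
    (hpa : p ∈ associatedPrimes R R) : Module.Injective R (Localization.AtPrime p) := by
  obtain ⟨_, _, h⟩ := hgen p hp hpa
  have hA : IsLocalRing.maximalIdeal (Localization.AtPrime p) ∈
      associatedPrimes (Localization.AtPrime p) (Localization.AtPrime p) := by
    apply Module.associatedPrimes.mem_associatedPrimes_of_comap_mem_associatedPrimes_of_isLocalizedModule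
      p.primeCompl (Algebra.linearMap R (Localization.AtPrime p))
    simpa [Localization.AtPrime.under_maximalIdeal] using hpa
  have := Module.Injective.of_finiteSelfInjDim _ h hA
  exact Module.Injective.of_flat R (Localization.AtPrime p) _

lemma shortExact_ker {R : Type} [CommRing R] {N N' : Type}
    [AddCommGroup N] [AddCommGroup N'] [Module R N] [Module R N']
    {g : N →ₗ[R] N'} (hg : Function.Surjective g) :
    (ModuleCat.shortComplexOfCompEqZero (LinearMap.ker g).subtype g
      (LinearMap.exact_subtype_ker_map g).linearMap_comp_eq_zero).ShortExact :=
  shortExact_of_exact (Submodule.injective_subtype _) hg (LinearMap.exact_subtype_ker_map g)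

section
variable {R : Type} [CommRing R] [IsNoetherianRing R] (p : Ideal R) [p.IsPrime]

lemma exists_lift_localization {N : Type} [AddCommGroup N] [Module R N] [Module.Finite R N]
    (h : N →ₗ[R] Localization.AtPrime p) :
    ∃ (g : N →ₗ[R] R) (s : R), s ∉ p ∧ ∀ x, algebraMap R _ (g x) = s • h x := by
  have := Module.finitePresentation_of_finite R N
  obtain ⟨g, s, hg⟩ := Module.FinitePresentation.exists_lift_of_isLocalizedModule p.primeCompl
    (Algebra.linearMap R (Localization.AtPrime p)) h
  exact ⟨g, s, s.2, fun x ↦ LinearMap.congr_fun hg x⟩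

lemma exists_ne_zero_of_mem_associatedPrimes {R : Type} [CommRing R] [IsNoetherianRing R]
    {p : Ideal R}
    (hp : p ∈ associatedPrimes R R) :
    ∃ y : R, (∀ r, r * y = 0 ↔ r ∈ p) := by
  obtain ⟨-, y, hy⟩ := (isAssociatedPrime_iff ..).1 hp
  exact ⟨y, fun r ↦ by rw [hy]; simp [Submodule.mem_colon_singleton]⟩

variable [Module.Injective R (Localization.AtPrime p)]

lemma exists_smul_eq_comp {N' N : Type} [AddCommGroup N] [Module R N] [Module.Finite R N]
    [AddCommGroup N'] [Module R N'] {i : N' →ₗ[R] N} (hi : Function.Injective i) (f : N' →ₗ[R] R) :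
    ∃ s ∉ p, ∃ g : N →ₗ[R] R, g ∘ₗ i = s • f := by
  obtain ⟨h, hh⟩ := Module.Injective.out i hi (Algebra.linearMap R (Localization.AtPrime p) ∘ₗ f)
  obtain ⟨g, s, hs, hg⟩ := exists_lift_localization p h
  have : Module.Finite R N' := Module.Finite.of_injective i hi
  have hz (x : N') : ∃ u ∉ p, u • (g ∘ₗ i - s • f) x = 0 := by
    have : algebraMap R (Localization.AtPrime p) ((g ∘ₗ i - s • f) x) = 0 := by
      simp [hg, hh, Algebra.smul_def]
    obtain ⟨u, hu⟩ := (IsLocalization.map_eq_zero_iff p.primeCompl _ _).1 this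
    exact ⟨u, u.2, hu⟩
  have hr : (⟨p, inferInstance⟩ : PrimeSpectrum R) ∉
      Module.support R (LinearMap.range (g ∘ₗ i - s • f)) := by
    rw [Module.notMem_support_iff']
    rintro ⟨-, x, rfl⟩
    obtain ⟨u, hu, h⟩ := hz x
    exact ⟨u, hu, Subtype.ext h⟩
  rw [Module.mem_support_iff_of_finite, SetLike.not_le_iff_exists] at hr
  obtain ⟨u, hu, hup⟩ := hr
  refine ⟨u * s, (Ideal.primeCompl p).mul_mem hup hs, u • g, ?_⟩
  ext x
  have := congrArg Subtype.val
    (Module.mem_annihilator.1 hu ⟨(g ∘ₗ i - s • f) x, LinearMap.mem_range_self _ x⟩)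
  simp only [LinearMap.sub_apply, LinearMap.comp_apply, LinearMap.smul_apply, SetLike.mk_smul_mk,
    smul_sub, ZeroMemClass.coe_zero, sub_eq_zero] at this
  simpa [mul_smul] using this

lemma exists_smul_extFunctor_eq_zero [HasDerivedCategory.{w} (ModuleCat.{0} R)]
    (m : ℕ) (N : Type) [AddCommGroup N] [Module R N] [Module.Finite R N]
    (z : (extFunctor (ModuleCat.of R R)).obj (m + 1) (ModuleCat.of R N)) :
    ∃ s ∉ p, s • z = 0 := by
  induction m generalizing N with
  | zero =>
    obtain ⟨n, f, hf⟩ := Module.Finite.exists_fin' R N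
    have : Projective (ModuleCat.of R (Fin n → R)) :=
      (IsProjective.iff_projective (R := R) (Fin n → R)).1 inferInstance
    obtain ⟨y, rfl⟩ := ((extFunctor (ModuleCat.of R R)).exact₃ (shortExact_ker hf)
      0).surjective_of_subsingleton
      (subsingleton_extFunctor_of_projective (ModuleCat.of R (Fin n → R)) _ _ (by simp)) z
    obtain ⟨y, rfl⟩ := (extFunctorZero _ _).surjective y
    obtain ⟨s, hs, g, hg⟩ := exists_smul_eq_comp p
      (i := (LinearMap.ker f).subtype) (Submodule.injective_subtype _) y
    refine ⟨s, hs, ?_⟩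
    rw [← map_smul, ← map_smul]
    refine ((extFunctor (ModuleCat.of R R)).exact₁ (shortExact_ker hf) 0 _).2
      ⟨extFunctorZero _ _ g, ?_⟩
    rw [extFunctor_map_extFunctorZero, ← hg]
    rfl
  | succ m ih =>
    obtain ⟨n, f, hf⟩ := Module.Finite.exists_fin' R N
    have : Projective (ModuleCat.of R (Fin n → R)) :=
      (IsProjective.iff_projective (R := R) (Fin n → R)).1 inferInstance
    obtain ⟨y, rfl⟩ := ((extFunctor (ModuleCat.of R R)).exact₃ (shortExact_ker hf)
      ((m + 1 : ℕ) : ℤ)).surjective_of_subsingleton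
      (subsingleton_extFunctor_of_projective (ModuleCat.of R (Fin n → R)) _ _ (by lia)) z
    obtain ⟨s, hs, h⟩ := ih (LinearMap.ker f) y
    exact ⟨s, hs, by rw [← map_smul, h, map_zero]⟩

lemma exists_hom_smul_ne_zero (hp : p ∈ associatedPrimes R R) {K : Type} [AddCommGroup K]
    [Module R K] [Module.Finite R K] (hK : ⟨p, inferInstance⟩ ∈ Module.support R K) :
    ∃ φ : K →ₗ[R] R, ∀ s ∉ p, s • φ ≠ 0 := by
  obtain ⟨y, hy⟩ := exists_ne_zero_of_mem_associatedPrimes hp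
  obtain ⟨x, hx⟩ := Module.mem_support_iff_exists_annihilator.1 hK
  have hxy : LinearMap.ker (LinearMap.toSpanSingleton R K x) ≤ LinearMap.ker
      (LinearMap.toSpanSingleton R (Localization.AtPrime p) (algebraMap R _ y)) := by
    intro r hr
    have : r ∈ p := hx ((Submodule.mem_annihilator_span_singleton _ _).2 (by simpa using hr))
    rw [LinearMap.mem_ker, LinearMap.toSpanSingleton_apply, Algebra.smul_def, ← map_mul,
      (hy r).2 this, map_zero]
  obtain ⟨h, hh⟩ := Module.Injective.out
    ((LinearMap.ker (LinearMap.toSpanSingleton R K x)).liftQ _ le_rfl)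
    (LinearMap.ker_eq_bot.1 (Submodule.ker_liftQ_eq_bot' _ _ rfl))
    ((LinearMap.ker (LinearMap.toSpanSingleton R K x)).liftQ _ hxy)
  have hx : h x = algebraMap R _ y := by
    have := hh (Submodule.Quotient.mk 1)
    rw [Submodule.liftQ_apply, Submodule.liftQ_apply] at this
    simpa using this
  obtain ⟨g, s, hs, hg⟩ := exists_lift_localization p h
  refine ⟨g, fun u hu h0 ↦ ?_⟩
  have h1 : algebraMap R (Localization.AtPrime p) (u • g x) = 0 := by
    rw [← LinearMap.smul_apply, h0, LinearMap.zero_apply, map_zero]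
  rw [smul_eq_mul, map_mul, hg, hx, Algebra.smul_def, ← map_mul, ← map_mul] at h1
  obtain ⟨v, hv⟩ := (IsLocalization.map_eq_zero_iff p.primeCompl _ _).1 h1
  rw [← mul_assoc, ← mul_assoc] at hv
  exact (p.primeCompl.mul_mem (p.primeCompl.mul_mem v.2 hu) hs) ((hy _).1 hv)

lemma mem_minimalPrimes_of_injective (hp : p ∈ associatedPrimes R R) : p ∈ minimalPrimes R := by
  obtain ⟨y, hy⟩ := exists_ne_zero_of_mem_associatedPrimes hp
  rw [minimalPrimes_eq_minimals]
  refine ⟨inferInstance, fun q (hq : q.IsPrime) hqp x hx ↦ ?_⟩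
  by_contra hxq
  let A := Localization.AtPrime p
  let M : Submodule A A := ⨅ r ∈ q, LinearMap.ker (LinearMap.mulLeft A (algebraMap R A r))
  have hM (a : A) : a ∈ M ↔ ∀ r ∈ q, algebraMap R A r * a = 0 := by simp [M]
  have key : M ≤ (IsLocalRing.maximalIdeal A) • M := by
    intro a ha
    rw [hM] at ha
    obtain ⟨h, hh⟩ := Module.Injective.out
      (LinearMap.lsmul R (R ⧸ q) x) (by
        refine (injective_iff_map_eq_zero _).2 fun z hz ↦ ?_
        obtain ⟨z, rfl⟩ := Ideal.Quotient.mk_surjective z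
        rw [LinearMap.lsmul_apply, Algebra.smul_def, Ideal.Quotient.algebraMap_eq, ← map_mul,
          Ideal.Quotient.eq_zero_iff_mem] at hz
        exact Ideal.Quotient.eq_zero_iff_mem.2 ((hq.mem_or_mem hz).resolve_left hxq))
      (Submodule.liftQ q (LinearMap.toSpanSingleton R A a) fun r hr ↦ by
        rw [LinearMap.mem_ker, LinearMap.toSpanSingleton_apply, Algebra.smul_def]
        exact ha r hr)
    have h1 : algebraMap R A x * h (Submodule.Quotient.mk 1) = a := by
      rw [← Algebra.smul_def, ← map_smul]
      have := hh (Submodule.Quotient.mk 1)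
      rw [Submodule.liftQ_apply, LinearMap.toSpanSingleton_apply, one_smul] at this
      exact this
    rw [← h1]
    refine Submodule.smul_mem_smul ?_ ((hM _).2 fun r hr ↦ ?_)
    · exact (IsLocalization.AtPrime.to_map_mem_maximal_iff A p x).2 hx
    · rw [← Algebra.smul_def, ← map_smul, ← Submodule.Quotient.mk_smul, smul_eq_mul, mul_one,
        (Submodule.Quotient.mk_eq_zero q).2 hr, map_zero]
  have hbot := Submodule.eq_bot_of_le_smul_of_le_jacobson_bot _ M (IsNoetherian.noetherian M) key
    (IsLocalRing.maximalIdeal_le_jacobson _)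
  have hyM : algebraMap R A y ∈ M := (hM _).2 fun r hr ↦ by
    rw [← map_mul, (hy r).2 (hqp hr), map_zero]
  rw [hbot, Submodule.mem_bot] at hyM
  obtain ⟨v, hv⟩ := (IsLocalization.map_eq_zero_iff p.primeCompl _ _).1 hyM
  exact v.2 ((hy _).1 hv)
end

section
variable {R : Type} [CommRing R] [IsNoetherianRing R] (p : Ideal R) [p.IsPrime]
  [Module.Injective R (Localization.AtPrime p)] [HasDerivedCategory.{w} (ModuleCat.{0} R)]

lemma exists_smul_eq_zero_of_range {S : ShortComplex (ModuleCat.{0} R)} [Projective S.X₂]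
    (hfin : Module.Finite R (LinearMap.ker S.g.hom ⧸ LinearMap.range S.moduleCatToCycles))
    (h : ∀ (m : ℕ) (z : (extFunctor (ModuleCat.of R R)).obj (m + 1)
      (ModuleCat.of R (LinearMap.range S.g.hom))), ∃ s ∉ p, s • z = 0)
    (m : ℕ) (z : (extFunctor (ModuleCat.of R R)).obj (m + 1)
      (ModuleCat.of R (LinearMap.range S.f.hom))) : ∃ s ∉ p, s • z = 0 := by
  let T := extFunctor (ModuleCat.of R R)
  have hZ (z : T.obj (m + 1) (ModuleCat.of R (LinearMap.ker S.g.hom))) : ∃ s ∉ p, s • z = 0 := by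
    have hS := shortExact_ker S.g.hom.surjective_rangeRestrict
    let e : T.obj (m + 1) (ModuleCat.of R (LinearMap.ker S.g.hom.rangeRestrict)) ≃ₗ[R]
        T.obj (m + 1) (ModuleCat.of R (LinearMap.ker S.g.hom)) :=
      T.mapEquiv _ (LinearEquiv.toModuleIso
        (LinearEquiv.ofEq _ _ (LinearMap.ker_rangeRestrict S.g.hom).symm))
    obtain ⟨z, rfl⟩ := e.surjective z
    obtain ⟨s, hs, hsz⟩ := h (m + 1) (T.δ hS (m + 1) z)
    refine ⟨s, hs, ?_⟩
    rw [← map_smul] at hsz ⊢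
    have := (T.exact₁ hS (m + 1)).injective_of_subsingleton
      (subsingleton_extFunctor_of_projective S.X₂ _ _ (by lia)) (hsz.trans (map_zero _).symm)
    rw [this, map_zero]
  have hS := shortExact_submodule (LinearMap.range S.moduleCatToCycles)
  have hinj : Function.Injective (LinearMap.ker S.g.hom).subtype := Submodule.injective_subtype _
  have hr : LinearMap.range S.f.hom =
      (LinearMap.range S.moduleCatToCycles).map (LinearMap.ker S.g.hom).subtype := by
    rw [← LinearMap.range_comp]
    rfl
  let e : T.obj (m + 1) (ModuleCat.of R (LinearMap.range S.moduleCatToCycles)) ≃ₗ[R]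
      T.obj (m + 1) (ModuleCat.of R (LinearMap.range S.f.hom)) :=
    T.mapEquiv _ (LinearEquiv.toModuleIso
      ((LinearEquiv.ofEq _ _ hr).trans (Submodule.equivMapOfInjective _ hinj _).symm))
  obtain ⟨z, rfl⟩ := e.surjective z
  obtain ⟨u, hu, huz⟩ := exists_smul_extFunctor_eq_zero p (m + 1) (LinearMap.ker S.g.hom ⧸ LinearMap.range S.moduleCatToCycles)
    (T.δ hS (m + 1) z)
  rw [← map_smul] at huz
  obtain ⟨y, hy⟩ := (T.exact₁ hS (m + 1) _).1 huz
  obtain ⟨s, hs, hsy⟩ := hZ y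
  refine ⟨s * u, p.primeCompl.mul_mem hs hu, ?_⟩
  rw [← map_smul, mul_smul, ← hy, ← map_smul]
  erw [hsy]
  rw [map_zero, map_zero]

lemma exists_cocycle_of_mem_support {S : ShortComplex (ModuleCat.{0} R)} [Projective S.X₂]
    (hp : p ∈ associatedPrimes R R) (hfin : Module.Finite R (LinearMap.ker S.g.hom ⧸ LinearMap.range S.moduleCatToCycles))
    (h : ∀ (m : ℕ) (z : (extFunctor (ModuleCat.of R R)).obj (m + 1)
      (ModuleCat.of R (LinearMap.range S.g.hom))), ∃ s ∉ p, s • z = 0)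
    (hH : ⟨p, inferInstance⟩ ∈ Module.support R (LinearMap.ker S.g.hom ⧸ LinearMap.range S.moduleCatToCycles)) :
    ∃ ψ : S.X₂ ⟶ ModuleCat.of R R, S.f ≫ ψ = 0 ∧ ∀ g : S.X₃ ⟶ ModuleCat.of R R, S.g ≫ g ≠ ψ := by
  obtain ⟨φ, hφ⟩ := exists_hom_smul_ne_zero p hp hH
  have hS := shortExact_ker S.g.hom.surjective_rangeRestrict
  let φ' : LinearMap.ker S.g.hom.rangeRestrict →ₗ[R] R :=
    φ ∘ₗ (LinearMap.range S.moduleCatToCycles).mkQ ∘ₗ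
      (LinearEquiv.ofEq _ _ (LinearMap.ker_rangeRestrict S.g.hom)).toLinearMap
  obtain ⟨s, hs, hsz⟩ := h 0 ((extFunctor (ModuleCat.of R R)).δ hS 0 (extFunctorZero _ _ φ'))
  rw [← map_smul, ← map_smul] at hsz
  obtain ⟨ψ, hψ⟩ := exists_comp_eq_of_δ_eq_zero hS _ hsz
  have hψ' (x : S.X₂) (hx : S.g.hom x = 0) : ψ x = s • φ (Submodule.Quotient.mk ⟨x, hx⟩) :=
    LinearMap.congr_fun hψ ⟨x, by rw [LinearMap.ker_rangeRestrict]; exact hx⟩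
  refine ⟨ModuleCat.ofHom ψ, ?_, ?_⟩
  · ext x
    have h0 : S.g.hom (S.f.hom x) = 0 := by
      rw [← LinearMap.comp_apply, ← ModuleCat.hom_comp, S.zero]; rfl
    refine (hψ' (S.f.hom x) h0).trans ?_
    have hx : (Submodule.Quotient.mk ⟨S.f.hom x, h0⟩ :
        LinearMap.ker S.g.hom ⧸ LinearMap.range S.moduleCatToCycles) = 0 :=
      (Submodule.Quotient.mk_eq_zero _).2 (LinearMap.mem_range.2 ⟨x, rfl⟩)
    exact (congrArg (fun y ↦ s • φ y) hx).trans (by rw [map_zero, smul_zero]; rfl)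
  · intro g hg
    refine hφ s hs (LinearMap.ext fun y ↦ ?_)
    obtain ⟨⟨x, hx⟩, rfl⟩ := Submodule.Quotient.mk_surjective _ y
    refine (hψ' x hx).symm.trans ?_
    change (ModuleCat.ofHom ψ).hom x = 0
    rw [← hg, ModuleCat.hom_comp, LinearMap.comp_apply, show S.g.hom x = 0 from hx, map_zero]
end

lemma nonempty_homology_equiv {R : Type} [CommRing R] (F : Cx.{0} R) (i j k : ℤ)
    (hij : i + 1 = j) (hjk : j + 1 = k) :
    Nonempty (F.homology j ≃ₗ[R] (LinearMap.ker (F.sc' i j k).g.hom ⧸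
      LinearMap.range (F.sc' i j k).moduleCatToCycles)) :=
  ⟨(ShortComplex.homologyMapIso (F.isoSc' i j k (by simp; lia) (by simp; lia)) ≪≫
    (F.sc' i j k).moduleCatHomologyIso).toLinearEquiv⟩

section
variable {R : Type} [CommRing R] [IsNoetherianRing R] (p : Ideal R) [p.IsPrime]
  [Module.Injective R (Localization.AtPrime p)] [HasDerivedCategory.{w} (ModuleCat.{0} R)]
  {F : Cx.{0} R} (hF : ∀ n, Projective (F.X n)) (hfin : ∀ n, Module.Finite R (F.homology n))
include hF hfin

lemma exists_smul_eq_zero_of_range_d {b : ℤ} (hb : ∀ n, b ≤ n → IsZero (F.X n)) (i j : ℤ)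
    (hij : i + 1 = j) (m : ℕ) (z : (extFunctor (ModuleCat.of R R)).obj (m + 1)
      (ModuleCat.of R (LinearMap.range (F.d i j).hom))) : ∃ s ∉ p, s • z = 0 := by
  obtain ⟨k, hk⟩ : ∃ k : ℕ, b ≤ j + k := ⟨(b - j).toNat, by lia⟩
  induction k generalizing i j m with
  | zero =>
    have : Subsingleton (F.X j) := ModuleCat.subsingleton_of_isZero (hb j (by lia))
    have := (extFunctor (ModuleCat.of R R)).subsingleton_obj (m + 1)
      (N := ModuleCat.of R (LinearMap.range (F.d i j).hom))
    exact ⟨1, p.primeCompl.one_mem, Subsingleton.elim _ _⟩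
  | succ k ih =>
    obtain ⟨e⟩ := nonempty_homology_equiv F i j (j + 1) hij rfl
    have := hfin j
    have : Projective (F.sc' i j (j + 1)).X₂ := hF j
    exact exists_smul_eq_zero_of_range p (S := F.sc' i j (j + 1)) (Module.Finite.equiv e)
      (fun m z ↦ ih j (j + 1) rfl m z (by lia)) m z

lemma notMem_support_homology (hp : p ∈ associatedPrimes R R)
    {b : ℤ} (hb : ∀ n, b ≤ n → IsZero (F.X n)) (i : ℤ)
    (h : ∀ f : Cochain F (sgl (ModuleCat.of R R)) i, δ i (i + 1) f = 0 →
      ∃ g : Cochain F (sgl (ModuleCat.of R R)) (i - 1), δ (i - 1) i g = f) :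
    ⟨p, inferInstance⟩ ∉ Module.support R (F.homology (-i)) := by
  intro hp'
  obtain ⟨e⟩ := nonempty_homology_equiv F (-i - 1) (-i) (-i + 1) (by lia) rfl
  have := hfin (-i)
  have : Projective (F.sc' (-i - 1) (-i) (-i + 1)).X₂ := hF (-i)
  rw [e.support_eq] at hp'
  obtain ⟨ψ, h0, hψ⟩ := exists_cocycle_of_mem_support p (S := F.sc' (-i - 1) (-i) (-i + 1)) hp
    (Module.Finite.equiv e) (exists_smul_eq_zero_of_range_d p hF hfin hb _ _ rfl) hp'
  let c := Cocycle.toSingleMk (K := F) (q := 0) ψ (n := i) (by lia) (-i - 1) (by lia) h0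
  obtain ⟨g, hg⟩ := h c.1 (c.δ_eq_zero (i + 1))
  obtain ⟨g, hg⟩ := (Cocycle.toSingleMk_mem_coboundaries_iff (K := F) (q := 0) ψ (n := i)
    (by lia) (-i - 1) (by lia) h0 (-i + 1) rfl).1
      ((mem_coboundaries_iff c (i - 1) (by lia)).2 ⟨g, hg⟩)
  exact hψ g hg
end

lemma mem_associatedPrimes_of_isMin {R : Type*} [CommRing R] [IsNoetherianRing R]
    {P : PrimeSpectrum R} (hP : IsMin P) : P.asIdeal ∈ associatedPrimes R R := by
  apply Module.associatedPrimes.minimalPrimes_annihilator_subset_associatedPrimes R R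
  rw [Module.annihilator_eq_bot.2 inferInstance]
  exact PrimeSpectrum.isMin_iff.1 hP

lemma isMin_of_le_coheight {α : Type*} [PartialOrder α] {d : ℕ} (hd : Order.krullDim α = d) {P : α}
    (hP : d ≤ Order.coheight P) : IsMin P := by
  intro Q hQ
  by_contra hc
  have h1 : Order.coheight P + 1 ≤ Order.coheight Q :=
    Order.coheight_add_one_le (lt_of_le_not_ge hQ hc)
  have h2 : Order.coheight Q ≤ d := by
    have := Order.coheight_le_krullDim Q
    rw [hd] at this
    exact_mod_cast this
  have h3 := (add_le_add_left hP 1).trans (h1.trans h2)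
  norm_cast at h3
  lia

namespace CohomologicalFunctor
variable {R : Type} [CommRing R] {T : CohomologicalFunctor.{w} R} [IsNoetherianRing R]
  [IsLocalRing R] (hfin : ∀ (j : ℤ) (N : ModuleCat.{0} R), Module.Finite R N →
    Module.Finite R (T.obj j N)) (t : ℤ)
  (hk : ∀ j, j ≠ t → Subsingleton (T.obj j (ModuleCat.of R (R ⧸ IsLocalRing.maximalIdeal R))))
  (hkt : Nontrivial (T.obj t (ModuleCat.of R (R ⧸ IsLocalRing.maximalIdeal R))))
  {n : ℕ} {P : PrimeSpectrum R} (hP : Order.coheight P = n)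
include hfin hk hkt hP

lemma notMem_support_of_isMin (hmin : IsMin P) (i : ℤ) (hi : t - n < i)
    (N : Type) [AddCommGroup N] [Module R N] [Module.Finite R N] :
    P ∉ Module.support R (T.obj i (ModuleCat.of R N)) := by
  intro h
  obtain ⟨Q, -, hQP, h'⟩ := T.exists_mem_support_quotient_prime i N h
  obtain rfl := le_antisymm hQP (hmin hQP)
  exact (mem_support_quotient_prime T hfin t hk hkt n Q hP).1 i hi h'

lemma mem_support_of_injective (hmin : IsMin P)
    {N : Type} [AddCommGroup N] [Module R N] [Module.Finite R N] {f : (R ⧸ P.asIdeal) →ₗ[R] N}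
    (hf : Function.Injective f) : P ∈ Module.support R (T.obj (t - n) (ModuleCat.of R N)) := by
  have hS := shortExact_of_exact hf (LinearMap.range f).mkQ_surjective
    (LinearMap.exact_map_mkQ_range f)
  refine (Module.support_subset_union_of_exact (T.exact₁ hS (t - n))
    (mem_support_quotient_prime T hfin t hk hkt n P hP).2).resolve_right ?_
  exact notMem_support_of_isMin hfin t hk hkt hP hmin _ (by lia) (N ⧸ LinearMap.range f)

lemma mem_support_ring (hmin : IsMin P) :
    P ∈ Module.support R (T.obj (t - n) (ModuleCat.of R R)) := by
  obtain ⟨-, f, hf⟩ := (isAssociatedPrime_iff_exists_injective_linearMap ..).1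
    (mem_associatedPrimes_of_isMin hmin)
  exact mem_support_of_injective hfin t hk hkt hP hmin hf

end CohomologicalFunctor

namespace CohomologicalFunctor
variable {R : Type} [CommRing R] {T : CohomologicalFunctor.{w} R} [IsNoetherianRing R]
  [IsLocalRing R] (hfin : ∀ (j : ℤ) (N : ModuleCat.{0} R), Module.Finite R N →
    Module.Finite R (T.obj j N)) (t : ℤ)
include hfin

lemma subsingleton_of_lt
    (hk : ∀ j, j < t → Subsingleton (T.obj j (ModuleCat.of R (R ⧸ IsLocalRing.maximalIdeal R))))
    {d : ℕ} (hd : ringKrullDim R = d) (j : ℤ) (hj : j < t - d)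
    (N : Type) [AddCommGroup N] [Module R N] [Module.Finite R N] :
    Subsingleton (T.obj j (ModuleCat.of R N)) := by
  refine T.subsingleton_of_forall_prime j N fun P _ ↦
    subsingleton_quotient_prime_of_lt T hfin t hk d P ?_ j hj
  have := Order.coheight_le_krullDim P
  rw [show Order.krullDim (PrimeSpectrum R) = d from hd] at this
  exact_mod_cast this

end CohomologicalFunctor

open DerivedCategory in
theorem exists_canonicalModule (R : Type) [CommRing R] [IsNoetherianRing R] [IsLocalRing R]
    [HasDerivedCategory.{w} (ModuleCat.{0} R)]
    (hgen : IsGenericallyGorenstein R)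
    (D : Cx.{0} R) (hD : IsNormalizedDualizingComplex R D)
    (hvan : ∀ i : ℕ, 1 ≤ i → (i : WithBot ℕ∞) ≤ ringKrullDim R →
      ExtVanishes D (sgl (ModuleCat.of R R)) (i : ℤ)) :
    ∃ (ω : ModuleCat.{0} R) (d : ℕ), ringKrullDim R = d ∧ Module.Finite R ω ∧
      (∀ j : ℤ, j ≠ d → Subsingleton ((extFunctor ω).obj j
        (ModuleCat.of R (R ⧸ IsLocalRing.maximalIdeal R)))) ∧
      Nonempty ((extFunctor ω).obj d (ModuleCat.of R (R ⧸ IsLocalRing.maximalIdeal R)) ≃ₗ[R]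
        R ⧸ IsLocalRing.maximalIdeal R) ∧
      ∀ i : ℤ, 1 ≤ i → i ≤ d → Subsingleton ((extFunctor (ModuleCat.of R R)).obj i ω) := by
  obtain ⟨t, hk, ⟨ek⟩⟩ := hD.exists_residue
  have hfin := hD.finite_obj
  have hnt := hD.nontrivial
  have hkt := ek.toEquiv.nontrivial
  have : FiniteDimensionalOrder (PrimeSpectrum R) := inferInstanceAs (FiniteRingKrullDim R)
  let c := LTSeries.longestOf (PrimeSpectrum R)
  have hd : ringKrullDim R = (c.length : ℕ) := Order.krullDim_eq_length_of_finiteDimensionalOrder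
  have hc : Order.coheight c.head = (c.length : ℕ) := by
    refine le_antisymm ?_ Order.length_le_coheight_head
    have := Order.coheight_le_krullDim c.head
    rw [show Order.krullDim (PrimeSpectrum R) = c.length from hd] at this
    exact_mod_cast this
  have hmin : IsMin c.head := isMin_of_le_coheight hd hc.ge
  generalize c.length = d at *
  generalize c.head = P at *
  have ht0 : 0 ≤ t := by
    by_contra! h
    exact not_subsingleton _ (CohomologicalFunctor.subsingleton_of_gt _ hfin t
      (fun j hj ↦ hk j hj.ne') 0 h R)
  have htd : t ≤ d := by
    by_contra! h
    exact not_subsingleton _ (CohomologicalFunctor.subsingleton_of_lt hfin t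
      (fun j hj ↦ hk j hj.ne) hd 0 (by lia) R)
  obtain ⟨F, π, hπ⟩ := exists_isSemiprojResolution D hD.vanish_neg
  obtain rfl : t = d := by
    by_contra hne
    obtain ⟨i, hi⟩ : ∃ i : ℕ, t - d = -(i : ℤ) := ⟨(d - t).toNat, by lia⟩
    have hsup := CohomologicalFunctor.mem_support_ring hfin t hk hkt hc hmin
    rw [hi, (derivedHomRingIso D _).support_eq] at hsup
    have := hπ.2.2
    obtain ⟨b, hb⟩ := hπ.2.1
    have hass := mem_associatedPrimes_of_isMin hmin
    have := Module.Injective.localization_of_generically hgen P.asIdeal hass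
    let e (n : ℤ) : F.homology n ≃ₗ[R] D.homology n :=
      (asIso (HomologicalComplex.homologyMap π n)).toLinearEquiv
    rw [← (e _).support_eq] at hsup
    refine notMem_support_homology P.asIdeal hπ.1
      (fun n ↦ have := hD.finite_homology n; Module.Finite.equiv (e n).symm) hass hb i ?_ hsup
    refine hvan i (by lia) ?_ F π hπ
    rw [hd]
    exact_mod_cast (show i ≤ d by lia)
  have : (Q.obj D).IsGE 0 := by
    rw [isGE_iff_subsingleton]
    exact fun i hi ↦ CohomologicalFunctor.subsingleton_of_lt hfin d (fun j hj ↦ hk j hj.ne) hd i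
      (by lia) R
  have := hD.isLE
  obtain ⟨ω, ⟨e⟩⟩ := exists_iso_singleFunctor_obj_of_isGE_of_isLE (Q.obj D) 0
  refine ⟨ω, d, hd, ?_, fun j hj ↦ ?_, ?_, fun i h1 h2 ↦ ?_⟩
  · have := hfin 0 (ModuleCat.of R R) (inferInstanceAs (Module.Finite R R))
    exact Module.Finite.equiv (((derivedHomEquivOfIso e 0 (ModuleCat.of R R)).trans
      (extFunctorZero (ModuleCat.of R R) ω).symm).trans (LinearMap.ringLmapEquivSelf R R ω))
  · have := hk j hj
    exact (derivedHomEquivOfIso e j _).symm.toEquiv.subsingleton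
  · exact ⟨(derivedHomEquivOfIso e d _).symm.trans ek⟩
  · obtain ⟨i, rfl⟩ := Int.eq_ofNat_of_zero_le (by lia : 0 ≤ i)
    have := subsingleton_hom_of_extVanishes (hvan i (by lia)
      (by rw [hd]; exact_mod_cast (show i ≤ d by lia))) ⟨F, π, hπ⟩
    exact (Linear.homCongr R e.symm (Iso.refl ((Q.obj (sgl (ModuleCat.of R R)))⟦(i : ℤ)⟧))).toEquiv.subsingleton

lemma Module.length_le_add_of_exact {R A B C : Type*} [CommRing R] [AddCommGroup A]
    [AddCommGroup B] [AddCommGroup C] [Module R A] [Module R B] [Module R C] {f : A →ₗ[R] B}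
    {g : B →ₗ[R] C} (h : Function.Exact f g) :
    Module.length R B ≤ Module.length R A + Module.length R C := by
  rw [Module.length_eq_add_of_exact (LinearMap.ker g).subtype g.rangeRestrict
    (Submodule.injective_subtype _) g.surjective_rangeRestrict (fun x ↦ by simp [Subtype.ext_iff])]
  refine add_le_add ?_ (Module.length_le_of_injective _ (Submodule.injective_subtype _))
  rw [h.linearMap_ker_eq]
  exact Module.length_le_of_surjective _ f.surjective_rangeRestrict

section
variable {R : Type} [CommRing R] [IsLocalRing R]

lemma Module.length_residueField :
    Module.length R (R ⧸ IsLocalRing.maximalIdeal R) = 1 := by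
  rw [Module.length_eq_one_iff, isSimpleModule_iff_isCoatom]
  exact (IsLocalRing.maximalIdeal.isMaximal R).out

lemma Module.length_quotient_prime_eq_top {P : Ideal R} [hP : P.IsPrime]
    (h : P ≠ IsLocalRing.maximalIdeal R) : Module.length R (R ⧸ P) = ⊤ := by
  by_contra hc
  rw [← ne_eq, Module.length_ne_top_iff, isFiniteLength_iff_isNoetherian_isArtinian] at hc
  have := hc.2
  have : IsArtinianRing (R ⧸ P) := isArtinian_of_tower R this
  have : IsField (R ⧸ P) := IsArtinianRing.isField_of_isDomain _
  exact h (IsLocalRing.eq_maximalIdeal (Ideal.Quotient.maximal_of_isField _ this))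

variable [IsNoetherianRing R]

lemma Module.length_linearMap_le {E : Type} [AddCommGroup E] [Module R E]
    (hE : Module.length R ((R ⧸ IsLocalRing.maximalIdeal R) →ₗ[R] E) ≤ 1)
    (N : Type) [AddCommGroup N] [Module R N] [Module.Finite R N] :
    Module.length R (N →ₗ[R] E) ≤ Module.length R N := by
  induction ‹Module.Finite R N› using
    IsNoetherianRing.induction_on_isQuotientEquivQuotientPrime R with
  | subsingleton N =>
    rw [(Module.length_eq_zero_iff (M := N →ₗ[R] E)).2 inferInstance]
    exact zero_le
  | quotient N p f =>
    rw [(f.arrowCongr (LinearEquiv.refl R E)).length_eq, f.length_eq]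
    obtain h | h := eq_or_ne p.asIdeal (IsLocalRing.maximalIdeal R)
    · rw [h, Module.length_residueField]
      exact hE
    · rw [Module.length_quotient_prime_eq_top h]
      exact le_top
  | exact N₁ N₂ N₃ f g hf hg hfg h₁ h₃ =>
    rw [Module.length_eq_add_of_exact f g hf hg hfg, add_comm]
    exact (Module.length_le_add_of_exact (f := LinearMap.lcomp R E g) (g := LinearMap.lcomp R E f)
      (LinearMap.exact_lcomp_of_exact_of_surjective _ hfg hg)).trans (add_le_add h₃ h₁)

lemma Module.length_ne_top_of_support (N : Type) [AddCommGroup N] [Module R N] [Module.Finite R N]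
    (hN : ∀ P ∈ Module.support R N, P = IsLocalRing.closedPoint R) :
    Module.length R N ≠ ⊤ := by
  induction ‹Module.Finite R N› using
    IsNoetherianRing.induction_on_isQuotientEquivQuotientPrime R with
  | subsingleton N => simp
  | quotient N p f =>
    have := hN p (by
      rw [f.support_eq, Module.mem_support_iff_of_finite, Ideal.annihilator_quotient])
    rw [f.length_eq, this]
    exact (Module.length_residueField (R := R)).trans_ne (by simp)
  | exact N₁ N₂ N₃ f g hf hg hfg h₁ h₃ =>
    rw [Module.length_eq_add_of_exact f g hf hg hfg]
    exact WithTop.add_ne_top.2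
      ⟨h₁ fun P hP ↦ hN P (Module.support_subset_of_injective f hf hP),
        h₃ fun P hP ↦ hN P (Module.support_subset_of_surjective g hg hP)⟩

lemma exists_eq_smul_id_of_length {E : Type} [AddCommGroup E] [Module R E] [Module.Finite R E]
    (hE : Module.length R ((R ⧸ IsLocalRing.maximalIdeal R) →ₗ[R] E) ≤ 1)
    (hfin : Module.length R E ≠ ⊤) (f : E →ₗ[R] E) : ∃ c : R, f = c • LinearMap.id := by
  let U : Submodule R (E →ₗ[R] E) := Submodule.span R {LinearMap.id}
  have h1 : Module.length R E ≤ Module.length R U := by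
    refine (Module.length_le_of_injective
      (((LinearMap.lcomp R E U.subtype).comp LinearMap.applyₗ)) ?_).trans
      (Module.length_linearMap_le hE U)
    intro a b hab
    exact LinearMap.congr_fun hab ⟨LinearMap.id, Submodule.mem_span_singleton_self _⟩
  have h2 := Module.length_linearMap_le hE E
  have h3 : Module.length R (E →ₗ[R] E) ≠ ⊤ := ne_top_of_le_ne_top hfin h2
  rw [Module.length_ne_top_iff, isFiniteLength_iff_isNoetherian_isArtinian] at h3
  have := h3.1
  have := h3.2
  have hU : U = ⊤ := by
    by_contra hU
    exact absurd (Submodule.length_lt hU) (not_lt.2 (h2.trans h1))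
  obtain ⟨c, hc⟩ := Submodule.mem_span_singleton.1 (hU ▸ Submodule.mem_top : f ∈ U)
  exact ⟨c, hc.symm⟩
end

section
variable {R : Type} [CommRing R] [IsNoetherianRing R]

lemma notMem_of_isSMulRegular_of_mem_associatedPrimes {W : Type} [AddCommGroup W] [Module R W]
    {x : R} (hx : IsSMulRegular W x) {q : Ideal R} (hq : q ∈ associatedPrimes R W) : x ∉ q := by
  obtain ⟨hqp, y, rfl⟩ := (isAssociatedPrime_iff ..).1 hq
  intro h
  have h0 : x • y = 0 := by simpa [Submodule.mem_colon_singleton] using h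
  have hy : y = 0 := hx (h0.trans (smul_zero x).symm)
  exact hqp.ne_top (by ext; simp [hy, Submodule.mem_colon_singleton])

lemma coheight_le_of_mem_support_quotSMulTop {W : Type} [AddCommGroup W] [Module R W]
    [Module.Finite R W] {x : R} (hx : IsSMulRegular W x) {n : ℕ}
    (hW : ∀ P ∈ Module.support R W, Order.coheight P ≤ (n + 1 : ℕ)) {P : PrimeSpectrum R}
    (hP : P ∈ Module.support R (QuotSMulTop x W)) : Order.coheight P ≤ n := by
  rw [Module.support_quotSMulTop, Set.mem_inter_iff, Module.mem_support_iff_of_finite] at hP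
  obtain ⟨q, hq, hqP⟩ := Ideal.exists_minimalPrimes_le hP.1
  have hqx := notMem_of_isSMulRegular_of_mem_associatedPrimes hx
    (Module.associatedPrimes.minimalPrimes_annihilator_subset_associatedPrimes R W hq)
  have hlt : (⟨q, hq.isPrime⟩ : PrimeSpectrum R) < P := by
    refine lt_of_le_of_ne hqP ?_
    rintro rfl
    exact hqx (by simpa using hP.2)
  have h1 := (Order.coheight_add_one_le hlt).trans (hW _ (by
    rw [Module.mem_support_iff_of_finite]; exact hq.le))
  rw [Nat.cast_add, Nat.cast_one] at h1
  exact (ENat.add_le_add_iff_right ENat.one_ne_top).1 h1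

variable [IsLocalRing R]

open scoped Pointwise in
lemma exists_eq_smul_id_of_quotSMulTop {W : Type} [AddCommGroup W] [Module R W]
    [Module.Finite R W] {x : R} (hx : IsSMulRegular W x) (hxm : x ∈ IsLocalRing.maximalIdeal R)
    (h : ∀ g : QuotSMulTop x W →ₗ[R] QuotSMulTop x W, ∃ c : R, g = c • LinearMap.id)
    (f : W →ₗ[R] W) : ∃ c : R, f = c • LinearMap.id := by
  have key (g : W →ₗ[R] W) : ∃ (c : R) (g' : W →ₗ[R] W), g = c • LinearMap.id + x • g' := by
    obtain ⟨c, hc⟩ := h (QuotSMulTop.map x g)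
    let g₀ : W →ₗ[R] W := g - c • LinearMap.id
    have hr (w : W) : g₀ w ∈ LinearMap.range (LinearMap.lsmul R W x) := by
      have h1 : Submodule.Quotient.mk (p := x • (⊤ : Submodule R W)) (g w) =
          c • Submodule.Quotient.mk w := LinearMap.congr_fun hc (Submodule.Quotient.mk w)
      rw [← Submodule.Quotient.mk_smul, Submodule.Quotient.eq] at h1
      obtain ⟨v, -, hv⟩ := h1
      exact ⟨v, hv⟩
    let e := LinearEquiv.ofInjective (LinearMap.lsmul R W x) hx
    refine ⟨c, e.symm.toLinearMap ∘ₗ g₀.codRestrict _ hr, ?_⟩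
    ext w
    have h2 : x • e.symm (g₀.codRestrict _ hr w) = g w - c • w :=
      congrArg Subtype.val (e.apply_symm_apply (g₀.codRestrict _ hr w))
    change g w = c • w + x • e.symm (g₀.codRestrict _ hr w)
    rw [h2, add_sub_cancel]
  have hle : (⊤ : Submodule R (W →ₗ[R] W)) ≤ Submodule.span R {LinearMap.id} := by
    refine Submodule.le_of_le_smul_of_le_jacobson_bot (I := IsLocalRing.maximalIdeal R)
      (IsNoetherian.noetherian _) (IsLocalRing.maximalIdeal_le_jacobson _) fun g _ ↦ ?_
    obtain ⟨c, g', rfl⟩ := key g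
    exact add_mem (Submodule.mem_sup_left (Submodule.mem_span_singleton.2 ⟨c, rfl⟩))
      (Submodule.mem_sup_right (Submodule.smul_mem_smul hxm Submodule.mem_top))
  obtain ⟨c, hc⟩ := Submodule.mem_span_singleton.1 (hle (Submodule.mem_top (x := f)))
  exact ⟨c, hc.symm⟩

theorem exists_eq_smul_id (n : ℕ) (W : Type) [AddCommGroup W] [Module R W] [Module.Finite R W]
    (hdim : ∀ P ∈ Module.support R W, Order.coheight P ≤ n)
    (h0 : ∀ i < n, Subsingleton (Abelian.Ext.{0}
      (ModuleCat.of R (R ⧸ IsLocalRing.maximalIdeal R)) (ModuleCat.of R W) i))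
    (hn : Module.length R (Abelian.Ext.{0}
      (ModuleCat.of R (R ⧸ IsLocalRing.maximalIdeal R)) (ModuleCat.of R W) n) ≤ 1)
    (f : W →ₗ[R] W) : ∃ c : R, f = c • LinearMap.id := by
  induction n generalizing W with
  | zero =>
    refine exists_eq_smul_id_of_length ?_ (Module.length_ne_top_of_support W fun P hP ↦ ?_) f
    · rwa [(Abelian.Ext.linearEquiv₀.trans ModuleCat.homLinearEquiv).length_eq] at hn
    · have := hdim P hP
      by_contra hc
      have h1 := Order.coheight_add_one_le
        (lt_of_le_of_ne (CohomologicalFunctor.le_closedPoint P) hc)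
      have h2 := le_add_self.trans (h1.trans this)
      simp at h2
  | succ n ih =>
    have hk : Subsingleton ((R ⧸ IsLocalRing.maximalIdeal R) →ₗ[R] W) :=
      have := h0 0 (by lia)
      (Abelian.Ext.addEquiv₀.trans (ModuleCat.homAddEquiv
        (M := ModuleCat.of R (R ⧸ IsLocalRing.maximalIdeal R))
        (N := ModuleCat.of R W))).symm.subsingleton
    obtain ⟨x, hxm, hx⟩ := IsSMulRegular.subsingleton_linearMap_iff.1 hk
    rw [Ideal.annihilator_quotient] at hxm
    have hS := IsSMulRegular.smulShortComplex_shortExact (M := ModuleCat.of R W) hx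
    have hinj (i : ℕ) (hi : i < n + 1) : Function.Injective (hS.extClass.postcompOfLinear R
        (ModuleCat.of R (R ⧸ IsLocalRing.maximalIdeal R)) (rfl : i + 1 = i + 1)) := by
      refine (injective_iff_map_eq_zero _).2 fun z hz ↦ ?_
      obtain ⟨y, rfl⟩ := Abelian.Ext.covariant_sequence_exact₃ _ hS z rfl hz
      have := h0 i hi
      rw [show y = 0 from Subsingleton.elim (α := Abelian.Ext.{0}
        (ModuleCat.of R (R ⧸ IsLocalRing.maximalIdeal R)) (ModuleCat.of R W) i) _ _,
        Abelian.Ext.zero_comp]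
    refine exists_eq_smul_id_of_quotSMulTop hx hxm (ih (QuotSMulTop x W)
      (fun P hP ↦ coheight_le_of_mem_support_quotSMulTop hx hdim hP) (fun i hi ↦ ?_)
      ((Module.length_le_of_injective _ (hinj n (by lia))).trans hn)) f
    have : Subsingleton (Abelian.Ext.{0} (ModuleCat.of R (R ⧸ IsLocalRing.maximalIdeal R))
      ((ModuleCat.of R W).smulShortComplex x).X₁ (i + 1)) := h0 (i + 1) (by lia)
    exact (hinj i (by lia)).subsingleton
end

/-- `ω` is a canonical module of the local ring `R` of dimension `d`: it is finitely generated and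
`Ext^j(k, ω)` is `k` for `j = d` and zero otherwise. -/
structure IsCanonicalModule {R : Type} [CommRing R] [IsLocalRing R]
    [HasDerivedCategory.{w} (ModuleCat.{0} R)] (ω : ModuleCat.{0} R) (d : ℕ) : Prop where
  krullDim_eq : ringKrullDim R = d
  finite : Module.Finite R ω
  subsingleton_residueField (j : ℤ) (hj : j ≠ d) : Subsingleton ((extFunctor ω).obj j
    (ModuleCat.of R (R ⧸ IsLocalRing.maximalIdeal R)))
  equiv_residueField : Nonempty ((extFunctor ω).obj d
    (ModuleCat.of R (R ⧸ IsLocalRing.maximalIdeal R)) ≃ₗ[R] R ⧸ IsLocalRing.maximalIdeal R)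

namespace IsCanonicalModule
variable {R : Type} [CommRing R] [IsLocalRing R]
  [HasDerivedCategory.{w} (ModuleCat.{0} R)] {ω : ModuleCat.{0} R} {d : ℕ}

lemma coheight_le (h : IsCanonicalModule ω d) (P : PrimeSpectrum R) : Order.coheight P ≤ d := by
  have h1 := (Order.coheight_le_krullDim P).trans_eq h.krullDim_eq
  exact_mod_cast h1

lemma nontrivial_residueField (h : IsCanonicalModule ω d) : Nontrivial ((extFunctor ω).obj d
    (ModuleCat.of R (R ⧸ IsLocalRing.maximalIdeal R))) := by
  obtain ⟨e⟩ := h.equiv_residueField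
  have : Nontrivial (R ⧸ IsLocalRing.maximalIdeal R) :=
    Ideal.Quotient.nontrivial_iff.2 (IsLocalRing.maximalIdeal.isMaximal R).ne_top
  exact e.toEquiv.nontrivial

variable [IsNoetherianRing R]

lemma finite_obj (h : IsCanonicalModule ω d) (j : ℤ) (N : ModuleCat.{0} R)
    (hN : Module.Finite R N) : Module.Finite R ((extFunctor ω).obj j N) :=
  have := h.finite
  finite_extFunctor ω j N hN

lemma subsingleton_of_gt (h : IsCanonicalModule ω d) (j : ℤ) (hj : d < j) (N : ModuleCat.{0} R)
    [Module.Finite R N] : Subsingleton ((extFunctor ω).obj j N) :=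
  CohomologicalFunctor.subsingleton_of_gt _ h.finite_obj d
    (fun j hj ↦ h.subsingleton_residueField j hj.ne') j hj N

lemma exists_eq_smul_id (h : IsCanonicalModule ω d) (f : ω →ₗ[R] ω) :
    ∃ c : R, f = c • LinearMap.id := by
  have := h.finite
  refine _root_.exists_eq_smul_id d ω (fun P _ ↦ h.coheight_le P) (fun i hi ↦ ?_) ?_ f
  · have := h.subsingleton_residueField i (by omega)
    exact (extFunctorEquiv _ ω i).toEquiv.subsingleton
  · obtain ⟨e⟩ := h.equiv_residueField
    exact (((extFunctorEquiv _ ω d).trans e).length_eq.trans Module.length_residueField).le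

lemma mem_associatedPrimes (h : IsCanonicalModule ω d) {q : Ideal R}
    (hq : q ∈ associatedPrimes R ω) : q ∈ associatedPrimes R R := by
  have hqp := hq.isPrime
  let P : PrimeSpectrum R := ⟨q, hqp⟩
  refine mem_associatedPrimes_of_isMin (P := P) (isMin_of_le_coheight h.krullDim_eq ?_)
  by_contra! hlt
  obtain ⟨n, hn⟩ := ENat.ne_top_iff_exists.1 (hlt.trans_le le_top).ne
  rw [← hn] at hlt
  have hlt' : n < d := by exact_mod_cast hlt
  obtain ⟨f, hf⟩ := (isAssociatedPrime_iff_exists_injective_linearMap ..).1 hq |>.2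
  have h0 := CohomologicalFunctor.subsingleton_quotient_prime_of_lt _ h.finite_obj d
    (fun j hj ↦ h.subsingleton_residueField j hj.ne) n P hn.ge 0 (by omega)
  have h1 := (extFunctorZero (ModuleCat.of R (R ⧸ q)) ω).toEquiv.subsingleton
  have h2 : f = 0 := h1.elim _ _
  have : Nontrivial (R ⧸ q) := Ideal.Quotient.nontrivial_iff.2 hqp.ne_top
  exact zero_ne_one (hf (by rw [h2]; rfl : f 0 = f 1))

lemma coheight_eq (h : IsCanonicalModule ω d) {P : PrimeSpectrum R} (hP : IsMin P) :
    Order.coheight P = d := by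
  obtain ⟨n, hn⟩ := ENat.ne_top_iff_exists.1 ((h.coheight_le P).trans_lt (ENat.natCast_lt_top d)).ne
  have hnd : n ≤ d := by
    have := hn.le.trans (h.coheight_le P)
    exact_mod_cast this
  have h1 := CohomologicalFunctor.mem_support_ring h.finite_obj d
    h.subsingleton_residueField h.nontrivial_residueField hn.symm hP
  by_contra hne
  have hne' : n ≠ d := fun h0 ↦ hne (by rw [← hn, h0])
  have := ModuleCat.projective_self R
  have h2 := subsingleton_extFunctor_of_projective (ModuleCat.of R R) ω (d - n) (by omega)
  exact Module.notMem_support_of_subsingleton h2 h1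

lemma exists_mul_eq_zero (h : IsCanonicalModule ω d) {P : PrimeSpectrum R} (hP : IsMin P)
    {r : R} (hr : ∀ x : ω, r • x = 0) : ∃ s ∉ P.asIdeal, s * r = 0 := by
  have hfin := h.finite_obj
  have hk := h.subsingleton_residueField
  have hkt := h.nontrivial_residueField
  have hc := h.coheight_eq hP
  let K : Ideal R := Ideal.span {r}
  by_contra! hs
  have hPK : P ∈ Module.support R K := by
    rw [Module.mem_support_iff_exists_annihilator]
    refine ⟨⟨r, Ideal.subset_span rfl⟩, fun s hsa ↦ ?_⟩
    by_contra hsP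
    refine hs s hsP ?_
    exact congrArg Subtype.val ((Submodule.mem_annihilator_span_singleton _ _).1 hsa)
  have hass : P.asIdeal ∈ associatedPrimes R K := by
    apply Module.associatedPrimes.minimalPrimes_annihilator_subset_associatedPrimes R K
    refine ⟨⟨P.2, Module.mem_support_iff_of_finite.1 hPK⟩, fun q hq hqP ↦ ?_⟩
    exact hP (b := ⟨q, hq.1⟩) hqP
  obtain ⟨f, hf⟩ := (isAssociatedPrime_iff_exists_injective_linearMap ..).1 hass |>.2
  have h1 := CohomologicalFunctor.mem_support_of_injective hfin d hk hkt hc hP hf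
  rw [sub_self, ← (extFunctorZero (ModuleCat.of R K) ω).support_eq,
    Module.mem_support_iff_exists_annihilator] at h1
  obtain ⟨φ, hφ⟩ := h1
  have hS := shortExact_submodule K
  have h2 := CohomologicalFunctor.notMem_support_of_isMin hfin d hk hkt hc hP 1 (by omega)
    (ModuleCat.of R (R ⧸ K))
  rw [Module.notMem_support_iff'] at h2
  obtain ⟨s, hsP, hs0⟩ := h2 ((extFunctor ω).δ hS 0 (extFunctorZero (ModuleCat.of R K) ω φ))
  rw [← map_smul, ← map_smul] at hs0
  obtain ⟨g, hg⟩ := exists_comp_eq_of_δ_eq_zero hS (s • φ) hs0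
  refine hsP (hφ ((Submodule.mem_annihilator_span_singleton _ _).2 (?_ : s • φ = 0)))
  refine hg.symm.trans (LinearMap.ext fun x ↦ ?_)
  obtain ⟨x, hx⟩ := x
  obtain ⟨a, rfl⟩ := Ideal.mem_span_singleton'.1 hx
  change g (a * r : R) = 0
  have : (a * r : R) = r • a := by rw [smul_eq_mul, mul_comm]
  rw [this, map_smul]
  exact hr _

lemma exists_apply_notMem (h : IsCanonicalModule ω d) {p : Ideal R} [p.IsPrime]
    [Module.Injective R (Localization.AtPrime p)] (hp : p ∈ associatedPrimes R R) :
    ∃ (f : ω →ₗ[R] R) (e : ω), f e ∉ p := by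
  have hmin : IsMin (⟨p, inferInstance⟩ : PrimeSpectrum R) :=
    PrimeSpectrum.isMin_iff.2 (mem_minimalPrimes_of_injective p hp)
  have := h.finite
  obtain ⟨n, e, he⟩ := Submodule.fg_iff_exists_fin_generating_family.1
    (Module.Finite.fg_top (R := R) (M := ω))
  let i₀ : R →ₗ[R] (Fin n → ω) := LinearMap.toSpanSingleton R _ e
  let A : Ideal R := LinearMap.ker i₀
  have hA (r : R) (hr : r ∈ A) : algebraMap R (Localization.AtPrime p) r = 0 := by
    have hr0 (x : ω) : r • x = 0 := by
      have hx : x ∈ Submodule.span R (Set.range e) := he ▸ Submodule.mem_top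
      induction hx using Submodule.span_induction with
      | mem x hx =>
        obtain ⟨j, rfl⟩ := hx
        exact congrFun (LinearMap.mem_ker.1 hr) j
      | zero => exact smul_zero r
      | add x y _ _ hx hy => rw [smul_add, hx, hy, add_zero]
      | smul a x _ hx => rw [smul_comm, hx, smul_zero]
    obtain ⟨s, hs, hs0⟩ := h.exists_mul_eq_zero hmin hr0
    exact (IsLocalization.map_eq_zero_iff p.primeCompl _ r).2 ⟨⟨s, hs⟩, hs0⟩
  let φ : (R ⧸ A) →ₗ[R] Localization.AtPrime p :=
    A.liftQ (Algebra.linearMap R _) (fun r hr ↦ hA r hr)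
  let i : (R ⧸ A) →ₗ[R] (Fin n → ω) := A.liftQ i₀ le_rfl
  have hi : Function.Injective i := LinearMap.ker_eq_bot.1 (Submodule.ker_liftQ_eq_bot _ _ _ le_rfl)
  obtain ⟨g, hg⟩ := Module.Injective.out i hi φ
  have hge : g e = 1 := by
    have h1 := hg (A.mkQ 1)
    have h2 : i (A.mkQ 1) = e := one_smul R e
    have h3 : φ (A.mkQ 1) = 1 := map_one (algebraMap R (Localization.AtPrime p))
    rw [← h2, h1, h3]
  obtain ⟨j, hj⟩ : ∃ j, IsUnit (g (Pi.single j (e j))) := by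
    by_contra! hj
    have h1 : g e ∈ IsLocalRing.maximalIdeal (Localization.AtPrime p) := by
      rw [← Finset.univ_sum_single e, map_sum]
      exact Ideal.sum_mem _ fun j _ ↦ (IsLocalRing.mem_maximalIdeal _).2 (hj j)
    rw [hge] at h1
    exact (IsLocalRing.mem_maximalIdeal _).1 h1 isUnit_one
  obtain ⟨f, s, hs, hf⟩ := exists_lift_localization p (g ∘ₗ LinearMap.single R (fun _ ↦ ω) j)
  refine ⟨f, e j, fun hfe ↦ ?_⟩
  have h1 : IsUnit (algebraMap R (Localization.AtPrime p) (f (e j))) := by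
    rw [hf, Algebra.smul_def]
    exact (IsLocalization.map_units _ (⟨s, hs⟩ : p.primeCompl)).mul hj
  exact (IsLocalization.AtPrime.isUnit_to_map_iff _ p _).1 h1 hfe

lemma exists_scalar (h : IsCanonicalModule ω d) {p : Ideal R} [p.IsPrime]
    [Module.Injective R (Localization.AtPrime p)] (hp : p ∈ associatedPrimes R R) :
    ∃ (f : ω →ₗ[R] R) (e : ω) (c : R), f e ∉ p ∧ c ∉ p ∧ ∀ x, f x • e = c • x := by
  obtain ⟨f, e, hfe⟩ := h.exists_apply_notMem hp
  obtain ⟨c, hc⟩ := h.exists_eq_smul_id (f.smulRight e)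
  have hc' (x : ω) : f x • e = c • x := DFunLike.congr_fun hc x
  refine ⟨f, e, c, hfe, fun hcp ↦ ?_, hc'⟩
  have h1 : f (f e • e) = f (c • e) := by rw [hc']
  rw [map_smul, map_smul] at h1
  rw [smul_eq_mul, smul_eq_mul] at h1
  have h2 : f e * f e ∈ p := h1 ▸ p.mul_mem_right _ hcp
  exact ((‹p.IsPrime›.mem_or_mem h2).elim hfe hfe)

lemma apply_smul_comm (h : IsCanonicalModule ω d)
    (hinj : ∀ (p : Ideal R) [p.IsPrime], p ∈ associatedPrimes R R →
      Module.Injective R (Localization.AtPrime p)) (g : ω →ₗ[R] R) (a b : ω) :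
    g a • b = g b • a := by
  by_contra hne
  obtain ⟨q, hq, hle⟩ := exists_le_isAssociatedPrime_of_isNoetherianRing R _ (sub_ne_zero.2 hne)
  have hqp := hq.isPrime
  have hqR := h.mem_associatedPrimes hq
  have := hinj q hqR
  obtain ⟨f, e, c, -, hc, hfc⟩ := h.exists_scalar hqR
  have key (a b : ω) : (c * c) • g a • b = (f a * f b * g e) • e := by
    have h1 : (c * c) • g a • b = g (c • a) • c • b := by
      rw [map_smul, smul_smul, smul_smul, smul_eq_mul]
      congr 1
      ring
    rw [h1, ← hfc a, ← hfc b, map_smul, smul_smul, smul_eq_mul]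
    congr 1
    ring
  have h0 : (c * c) • (g a • b - g b • a) = 0 := by
    rw [smul_sub, key, key, mul_comm (f a), sub_self]
  have h1 : c * c ∈ q := hle (Submodule.mem_colon_singleton.2 ((Submodule.mem_bot R).2 h0))
  exact (hqp.mem_or_mem h1).elim hc hc

end IsCanonicalModule

section
variable {R : Type} [CommRing R]

lemma exists_range_eq_ker [IsNoetherianRing R] {F G : Type} [AddCommGroup F] [Module R F]
    [AddCommGroup G] [Module R G] [Module.Finite R G] (f : G →ₗ[R] F) :
    ∃ (n : ℕ) (g : (Fin n → R) →ₗ[R] G), LinearMap.range g = LinearMap.ker f := by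
  obtain ⟨n, g, hg⟩ := Module.Finite.exists_fin' R (LinearMap.ker f)
  refine ⟨n, (LinearMap.ker f).subtype ∘ₗ g, ?_⟩
  rw [LinearMap.range_comp, LinearMap.range_eq_top.2 hg, Submodule.map_top, Submodule.range_subtype]

lemma CohomologicalFunctor.subsingleton_of_equiv (T : CohomologicalFunctor.{w} R) (j : ℤ)
    {N N' : Type} [AddCommGroup N] [Module R N] [AddCommGroup N'] [Module R N'] (e : N ≃ₗ[R] N')
    (h : Subsingleton (T.obj j (ModuleCat.of R N'))) :
    Subsingleton (T.obj j (ModuleCat.of R N)) :=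
  (T.mapEquiv j e.toModuleIso).symm.toEquiv.subsingleton

variable [HasDerivedCategory.{w} (ModuleCat.{0} R)]

lemma subsingleton_extFunctor_of_free {N : Type} [AddCommGroup N] [Module R N] [Module.Free R N]
    (M : ModuleCat.{0} R) (j : ℤ) (hj : 1 ≤ j) :
    Subsingleton ((extFunctor M).obj j (ModuleCat.of R N)) :=
  have : Projective (ModuleCat.of R N) := (IsProjective.iff_projective (R := R) N).1 inferInstance
  subsingleton_extFunctor_of_projective _ _ _ hj

/-- Dimension shifting along a submodule of a free module. -/
lemma subsingleton_extFunctor_submodule {N : Type} [AddCommGroup N] [Module R N] [Module.Free R N]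
    (K : Submodule R N) (M : ModuleCat.{0} R) (j : ℤ) (hj : 1 ≤ j)
    (h : Subsingleton ((extFunctor M).obj (j + 1) (ModuleCat.of R (N ⧸ K)))) :
    Subsingleton ((extFunctor M).obj j (ModuleCat.of R K)) :=
  ((extFunctor M).exact₁ (shortExact_submodule K) j).subsingleton
    (subsingleton_extFunctor_of_free (N := N) M j hj) h

/-- Maps out of a submodule extend when the first `Ext` of the quotient vanishes. -/
lemma exists_extension {N : Type} [AddCommGroup N] [Module R N]
    (K : Submodule R N) (M : ModuleCat.{0} R)
    (h : Subsingleton ((extFunctor M).obj 1 (ModuleCat.of R (N ⧸ K)))) (f : K →ₗ[R] M) :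
    ∃ g : N →ₗ[R] M, g ∘ₗ K.subtype = f :=
  exists_comp_eq_of_δ_eq_zero (shortExact_submodule K) f (h.elim _ _)

lemma range_dualMap_eq_ker {F G H : Type} [AddCommGroup F] [Module R F]
    [AddCommGroup G] [Module R G] [AddCommGroup H] [Module R H]
    {f : G →ₗ[R] F} {g : H →ₗ[R] G} (hfg : LinearMap.range g = LinearMap.ker f)
    (h : Subsingleton ((extFunctor (ModuleCat.of R R)).obj 1
      (ModuleCat.of R (F ⧸ LinearMap.range f)))) :
    LinearMap.range f.dualMap = LinearMap.ker g.dualMap := by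
  ext ψ
  constructor
  · rintro ⟨φ, rfl⟩
    refine LinearMap.mem_ker.2 (LinearMap.ext fun x ↦ ?_)
    have : f (g x) = 0 := by
      rw [← LinearMap.mem_ker, ← hfg]
      exact ⟨x, rfl⟩
    change φ (f (g x)) = 0
    rw [this, map_zero]
  · intro hψ
    have hle : LinearMap.ker f ≤ LinearMap.ker ψ := by
      rw [← hfg]
      rintro _ ⟨x, rfl⟩
      exact DFunLike.congr_fun (LinearMap.mem_ker.1 hψ) x
    let ψ' : LinearMap.range f →ₗ[R] R :=
      ((LinearMap.ker f).liftQ ψ hle) ∘ₗ f.quotKerEquivRange.symm.toLinearMap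
    obtain ⟨φ, hφ⟩ := exists_extension _ (ModuleCat.of R R) h ψ'
    refine ⟨φ, LinearMap.ext fun x ↦ ?_⟩
    have h1 := DFunLike.congr_fun hφ ⟨f x, x, rfl⟩
    refine h1.trans ?_
    change (LinearMap.ker f).liftQ ψ hle (f.quotKerEquivRange.symm ⟨f x, x, rfl⟩) = ψ x
    have h2 : f.quotKerEquivRange.symm ⟨f x, x, rfl⟩ = (LinearMap.ker f).mkQ x := by
      rw [LinearEquiv.symm_apply_eq]
      rfl
    rw [h2]
    rfl

end

namespace IsCanonicalModule
variable {R : Type} [CommRing R] [IsNoetherianRing R] [IsLocalRing R]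
  [HasDerivedCategory.{w} (ModuleCat.{0} R)] {ω : ModuleCat.{0} R} {d : ℕ}

lemma subsingleton_quotient_range_dualMap (h : IsCanonicalModule ω d) (n : ℕ) :
    ∀ {F G : Type} [AddCommGroup F] [Module R F] [Module.Free R F]
      [AddCommGroup G] [Module R G] [Module.Free R G] [Module.Finite R G] (f : G →ₗ[R] F)
      (_ : ∀ i : ℤ, 1 ≤ i → i ≤ n → Subsingleton ((extFunctor (ModuleCat.of R R)).obj i
        (ModuleCat.of R (F ⧸ LinearMap.range f))))
      (i : ℤ) (_ : 1 ≤ i) (_ : d + 1 - n ≤ i),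
      Subsingleton ((extFunctor ω).obj i
        (ModuleCat.of R (Module.Dual R G ⧸ LinearMap.range f.dualMap))) := by
  induction n with
  | zero =>
    intro F G _ _ _ _ _ _ _ f _ i _ hi
    have : Module.Finite R (Module.Dual R G ⧸ LinearMap.range f.dualMap) := inferInstance
    exact h.subsingleton_of_gt i (by push_cast at hi; omega) (ModuleCat.of R _)
  | succ n ih =>
    intro F G _ _ _ _ _ _ _ f hf i hi1 hi
    obtain ⟨k, g, hg⟩ := exists_range_eq_ker f
    have e : (Module.Dual R G ⧸ LinearMap.range f.dualMap) ≃ₗ[R] LinearMap.range g.dualMap :=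
      (Submodule.quotEquivOfEq _ _
        (range_dualMap_eq_ker hg (hf 1 le_rfl (by push_cast; omega)))).trans
        g.dualMap.quotKerEquivRange
    refine CohomologicalFunctor.subsingleton_of_equiv _ i (N' := LinearMap.range g.dualMap) e ?_
    refine subsingleton_extFunctor_submodule _ ω i hi1 ?_
    refine ih g (fun j hj1 hjn ↦ ?_) (i + 1) (by omega) (by push_cast at hi; omega)
    refine CohomologicalFunctor.subsingleton_of_equiv _ j
      ((Submodule.quotEquivOfEq _ _ hg).trans f.quotKerEquivRange) ?_
    exact subsingleton_extFunctor_submodule _ _ j hj1 (hf (j + 1) (by omega) (by push_cast; omega))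

end IsCanonicalModule

lemma hasInjectiveDimensionLT_of_forall_ideal {R : Type} [CommRing R] (n : ℕ) :
    ∀ (Y : ModuleCat.{0} R),
      (∀ I : Ideal R, Subsingleton (Abelian.Ext.{0} (ModuleCat.of R (R ⧸ I)) Y (n + 1))) →
      HasInjectiveDimensionLT Y (n + 1) := by
  induction n with
  | zero =>
    intro Y h
    rw [zero_add, ← injective_iff_hasInjectiveDimensionLT_one]
    let := HasDerivedCategory.standard (ModuleCat.{0} R)
    have : Module.Injective R Y := by
      refine Module.Baer.injective fun I g ↦ ?_
      have hI := h I
      have h1 : Subsingleton ((extFunctor Y).obj 1 (ModuleCat.of R (R ⧸ I))) :=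
        (extFunctorEquiv (ModuleCat.of R (R ⧸ I)) Y 1).symm.toEquiv.subsingleton
      obtain ⟨g', hg'⟩ := exists_extension I Y h1 g
      exact ⟨g', fun x hx ↦ DFunLike.congr_fun hg' ⟨x, hx⟩⟩
    exact Module.injective_object_of_injective_module R Y
  | succ n ih =>
    intro Y h
    let S : ShortComplex (ModuleCat.{0} R) :=
      ShortComplex.mk (Injective.ι Y) (cokernel.π (Injective.ι Y)) (cokernel.condition _)
    have hS : S.ShortExact :=
      { exact := ShortComplex.exact_cokernel _ }
    have : Injective S.X₂ := inferInstanceAs (Injective (Injective.under Y))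
    refine hS.hasInjectiveDimensionLT_X₁ (n + 1) (ih _ fun I ↦ ?_) ?_
    · refine subsingleton_of_forall_eq 0 fun x ↦ ?_
      obtain ⟨y, rfl⟩ := Abelian.Ext.covariant_sequence_exact₃ _ hS x rfl
        ((h I).elim _ _)
      rw [Abelian.Ext.eq_zero_of_injective y, Abelian.Ext.zero_comp]
    · exact hasInjectiveDimensionLT_of_ge _ 1 _ (by omega)

lemma IsLocalRing.exists_minimal_generators {R : Type} [CommRing R] [IsLocalRing R]
    (W : Type) [AddCommGroup W] [Module R W] [Module.Finite R W] :
    ∃ (n : ℕ) (e : Fin n → W), Submodule.span R (Set.range e) = ⊤ ∧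
      ∀ r : Fin n → R, ∑ i, r i • e i = 0 → ∀ i, r i ∈ maximalIdeal R := by
  let b := Module.finBasis (ResidueField R) (TensorProduct R (ResidueField R) W)
  choose e he using fun i ↦ TensorProduct.mk_surjective R W (ResidueField R)
    Ideal.Quotient.mk_surjective (b i)
  refine ⟨_, e, span_eq_top_of_tmul_eq_basis e b he, fun r hr i ↦ ?_⟩
  rw [← residue_eq_zero_iff]
  refine Fintype.linearIndependent_iff.1 b.linearIndependent (fun i ↦ residue R (r i)) ?_ i
  have h1 := congrArg (TensorProduct.mk R (ResidueField R) W 1) hr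
  rw [map_sum, map_zero] at h1
  rw [← h1]
  refine Finset.sum_congr rfl fun i _ ↦ ?_
  rw [map_smul, he]
  exact algebraMap_smul (ResidueField R) (r i) (b i)

namespace IsCanonicalModule
variable {R : Type} [CommRing R] [IsNoetherianRing R] [IsLocalRing R]
  [HasDerivedCategory.{w} (ModuleCat.{0} R)] {ω : ModuleCat.{0} R} {d : ℕ}

lemma exists_span_singleton_eq_top (h : IsCanonicalModule ω d)
    (hinj : ∀ (p : Ideal R) [p.IsPrime], p ∈ associatedPrimes R R →
      Module.Injective R (Localization.AtPrime p))
    (hext : ∀ i : ℤ, 1 ≤ i → i ≤ d → Subsingleton ((extFunctor (ModuleCat.of R R)).obj i ω)) :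
    ∃ e : ω, Submodule.span R {e} = ⊤ := by
  have := h.finite
  obtain ⟨n, e, he, hmin⟩ := IsLocalRing.exists_minimal_generators (R := R) ω
  have hn : ∀ i j : Fin n, i = j := by
    intro a b
    by_contra hab
    let π : (Fin n → R) →ₗ[R] ω := Fintype.linearCombination R e
    have hπ : Function.Surjective π := by
      rw [← LinearMap.range_eq_top, Fintype.range_linearCombination, he]
    obtain ⟨m, f, hf⟩ := exists_range_eq_ker π
    have h1 := h.subsingleton_quotient_range_dualMap d f (fun i hi hid ↦
      CohomologicalFunctor.subsingleton_of_equiv _ i ((Submodule.quotEquivOfEq _ _ hf).trans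
        (π.quotKerEquivOfSurjective hπ)) (hext i hi hid)) 1 le_rfl (by omega)
    -- The antisymmetric element of `F ⊗ ω`, seen as a map on the dual.
    let u : Module.Dual R (Fin n → R) →ₗ[R] ω :=
      (LinearMap.applyₗ (Pi.single a 1)).smulRight (e b) -
        (LinearMap.applyₗ (Pi.single b 1)).smulRight (e a)
    have hu : LinearMap.ker f.dualMap ≤ LinearMap.ker u := by
      intro ψ hψ
      have hle : LinearMap.ker π ≤ LinearMap.ker ψ := by
        rw [← hf]
        rintro _ ⟨x, rfl⟩
        exact DFunLike.congr_fun (LinearMap.mem_ker.1 hψ) x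
      let g : ω →ₗ[R] R :=
        (LinearMap.ker π).liftQ ψ hle ∘ₗ (π.quotKerEquivOfSurjective hπ).symm.toLinearMap
      have hg (x : Fin n → R) : g (π x) = ψ x := by
        have h2 : (π.quotKerEquivOfSurjective hπ).symm (π x) = (LinearMap.ker π).mkQ x := by
          rw [LinearEquiv.symm_apply_eq]
          rfl
        change (LinearMap.ker π).liftQ ψ hle ((π.quotKerEquivOfSurjective hπ).symm (π x)) = ψ x
        rw [h2]
        rfl
      have hge (i : Fin n) : g (e i) = ψ (Pi.single i 1) := by
        rw [← hg, Fintype.linearCombination_apply_single, one_smul]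
      refine LinearMap.mem_ker.2 ?_
      change ψ (Pi.single a 1) • e b - ψ (Pi.single b 1) • e a = 0
      rw [← hge, ← hge, h.apply_smul_comm hinj, sub_self]
    let χ : LinearMap.range f.dualMap →ₗ[R] ω :=
      (LinearMap.ker f.dualMap).liftQ u hu ∘ₗ f.dualMap.quotKerEquivRange.symm.toLinearMap
    obtain ⟨η, hη⟩ := exists_extension _ ω h1 χ
    have hηu (ψ : Module.Dual R (Fin n → R)) : η (ψ ∘ₗ f) = u ψ := by
      refine (DFunLike.congr_fun hη ⟨f.dualMap ψ, ψ, rfl⟩).trans ?_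
      have h2 : f.dualMap.quotKerEquivRange.symm ⟨f.dualMap ψ, ψ, rfl⟩ =
          (LinearMap.ker f.dualMap).mkQ ψ := by
        rw [LinearEquiv.symm_apply_eq]
        rfl
      change (LinearMap.ker f.dualMap).liftQ u hu
        (f.dualMap.quotKerEquivRange.symm ⟨f.dualMap ψ, ψ, rfl⟩) = u ψ
      rw [h2]
      rfl
    let ψ : Module.Dual R (Fin n → R) := LinearMap.proj a
    have hψ : ∀ x, (ψ ∘ₗ f) x ∈ IsLocalRing.maximalIdeal R := by
      intro x
      refine hmin (f x) ?_ a
      have : f x ∈ LinearMap.ker π := hf ▸ ⟨x, rfl⟩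
      rwa [LinearMap.mem_ker, Fintype.linearCombination_apply] at this
    have hmem : u ψ ∈ IsLocalRing.maximalIdeal R • (⊤ : Submodule R ω) := by
      have hsum : ψ ∘ₗ f = ∑ j, (ψ ∘ₗ f) (Pi.single j 1) • LinearMap.proj (R := R) j := by
        refine LinearMap.pi_ext' fun j ↦ LinearMap.ext_ring ?_
        simp [Pi.single_apply]
      rw [← hηu, hsum, map_sum]
      refine Submodule.sum_mem _ fun j _ ↦ ?_
      rw [map_smul]
      exact Submodule.smul_mem_smul (hψ _) Submodule.mem_top
    have hub : u ψ = e b := by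
      change ((Pi.single a 1 : Fin n → R) a) • e b - ((Pi.single b 1 : Fin n → R) a) • e a = e b
      rw [Pi.single_eq_same, Pi.single_eq_of_ne hab, one_smul, zero_smul, sub_zero]
    rw [hub, ← he, Submodule.mem_ideal_smul_span_iff_exists_sum] at hmem
    obtain ⟨c, hc, hsum⟩ := hmem
    have h3 : ∑ i, ((Pi.single b 1 : Fin n → R) - fun i ↦ c i) i • e i = 0 := by
      have h4 : ∑ i, c i • e i = e b := by
        rw [← hsum, Finsupp.sum_fintype]
        exact fun i ↦ zero_smul R (e i)
      have h5 : ∑ i, (Pi.single b 1 : Fin n → R) i • e i = e b := by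
        rw [Finset.sum_eq_single b]
        · rw [Pi.single_eq_same, one_smul]
        · intro i _ hi
          rw [Pi.single_eq_of_ne hi, zero_smul]
        · exact fun h ↦ absurd (Finset.mem_univ b) h
      rw [← sub_eq_zero.2 (h5.trans h4.symm), ← Finset.sum_sub_distrib]
      exact Finset.sum_congr rfl fun i _ ↦ sub_smul _ _ _
    have h6 := hmin _ h3 b
    rw [Pi.sub_apply, Pi.single_eq_same] at h6
    have h7 := Ideal.add_mem _ h6 (hc b)
    rw [sub_add_cancel] at h7
    exact (IsLocalRing.maximalIdeal.isMaximal R).ne_top ((Ideal.eq_top_iff_one _).2 h7)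
  obtain hn0 | ⟨⟨i⟩⟩ := isEmpty_or_nonempty (Fin n)
  · refine ⟨0, ?_⟩
    rw [← he, Set.range_eq_empty, Submodule.span_zero_singleton, Submodule.span_empty]
  · refine ⟨e i, ?_⟩
    rw [← he]
    congr 1
    ext x
    constructor
    · rintro rfl
      exact ⟨i, rfl⟩
    · rintro ⟨j, rfl⟩
      rw [hn j i]
      rfl

lemma nonempty_equiv (h : IsCanonicalModule ω d)
    (hinj : ∀ (p : Ideal R) [p.IsPrime], p ∈ associatedPrimes R R →
      Module.Injective R (Localization.AtPrime p))
    (hext : ∀ i : ℤ, 1 ≤ i → i ≤ d → Subsingleton ((extFunctor (ModuleCat.of R R)).obj i ω)) :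
    Nonempty (R ≃ₗ[R] ω) := by
  obtain ⟨e, he⟩ := h.exists_span_singleton_eq_top hinj hext
  refine ⟨LinearEquiv.ofBijective (LinearMap.toSpanSingleton R ω e) ⟨?_, ?_⟩⟩
  · rw [injective_iff_map_eq_zero]
    intro r hr
    by_contra hne
    obtain ⟨q, hq, hle⟩ := exists_le_isAssociatedPrime_of_isNoetherianRing R r hne
    have hqp := hq.isPrime
    have := hinj q hq
    obtain ⟨f, x, hfx⟩ := h.exists_apply_notMem hq
    refine hfx (hle (Submodule.mem_colon_singleton.2 ((Submodule.mem_bot R).2 ?_)))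
    obtain ⟨a, rfl⟩ := Submodule.mem_span_singleton.1 (he ▸ Submodule.mem_top : x ∈ _)
    have h0 : r • e = 0 := hr
    rw [smul_eq_mul, mul_comm, ← smul_eq_mul, ← map_smul, smul_comm, h0, smul_zero, map_zero]
  · rw [← LinearMap.range_eq_top, LinearMap.range_toSpanSingleton, he]

lemma hasInjectiveDimensionLT (h : IsCanonicalModule ω d) :
    HasInjectiveDimensionLT ω (d + 1) := by
  refine hasInjectiveDimensionLT_of_forall_ideal d ω fun I ↦ ?_
  have h1 := h.subsingleton_of_gt ((d + 1 : ℕ) : ℤ) (by omega) (ModuleCat.of R (R ⧸ I))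
  exact (extFunctorEquiv (ModuleCat.of R (R ⧸ I)) ω (d + 1)).toEquiv.subsingleton

end IsCanonicalModule

/-- If `(R, 𝔪, k)` is a generically Gorenstein commutative noetherian
local ring with a normalized dualizing complex `D` and `Ext^i_R(D, R) = 0` for all
`1 ≤ i ≤ dim R`, then `R` is Gorenstein. -/
theorem isGorenstein_of_genericallyGorenstein_of_ext_dualizing_vanishes
    (R : Type) [CommRing R] [IsNoetherianRing R] [IsLocalRing R]
    (hgen : IsGenericallyGorenstein R)
    (D : Cx R) (hD : IsNormalizedDualizingComplex R D)
    (hvan : ∀ i : ℕ, 1 ≤ i → (i : WithBot ℕ∞) ≤ ringKrullDim R →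
      ExtVanishes D (sgl (ModuleCat.of R R)) (i : ℤ)) :
    HasFiniteSelfInjDim R := by
  let := HasDerivedCategory.standard (ModuleCat.{0} R)
  obtain ⟨ω, d, hd, hfin, hk, hkt, hext⟩ := exists_canonicalModule R hgen D hD hvan
  have h : IsCanonicalModule ω d := ⟨hd, hfin, hk, hkt⟩
  obtain ⟨e⟩ := h.nonempty_equiv
    (fun p _ hp ↦ Module.Injective.localization_of_generically hgen p hp) hext
  have := h.hasInjectiveDimensionLT
  have hR : HasInjectiveDimensionLT (ModuleCat.of R R) (d + 1) :=
    hasInjectiveDimensionLT_of_iso (e.symm.toModuleIso : ω ≅ ModuleCat.of R R) (d + 1)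
  refine ⟨d, fun M i hi ↦ ?_⟩
  obtain ⟨i, rfl⟩ : ∃ j, i = j + 1 := ⟨i - 1, by omega⟩
  rw [isZero_ext_succ_iff]
  exact HasInjectiveDimensionLT.subsingleton _ (d + 1) (i + 1) hi M
end
end

section
/- Let P → Q be a finite homomorphism of commutative rings with P noetherian local, and let N be a finitely generated Q-module. If Ass_P(N ⊗_Q N) ∪ Ass_P(Q) ⊆ Ass(P), and N_p ≅ Q_p as Q_p-modules for every prime ideal p ∈ Ass(P), then N ≅ Q as Q-modules. -/
open TensorProduct

/-- An element of a module over a noetherian ring vanishes as soon as no associated prime contains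
its annihilator. -/
theorem eq_zero_of_forall_associatedPrimes_exists_smul_eq_zero {R M : Type*} [CommRing R]
    [IsNoetherianRing R] [AddCommGroup M] [Module R M] (m : M)
    (h : ∀ p ∈ associatedPrimes R M, ∃ s ∉ p, s • m = 0) : m = 0 := by
  by_contra hm
  obtain ⟨p, hp, hle⟩ := exists_le_isAssociatedPrime_of_isNoetherianRing R m hm
  obtain ⟨s, hs, hsm⟩ := h p hp
  exact hs (hle (by rwa [Submodule.mem_colon_singleton, Submodule.mem_bot]))

section Localization

variable {R M : Type*} [CommRing R] [AddCommGroup M] [Module R M] (S : Submonoid R)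

/-- If `S⁻¹M ≅ S⁻¹R`, then up to multiplication by `S` all elements of `M` are multiples of a
single one. -/
theorem LocalizedModule.exists_forall_smul_eq_smul_of_equiv
    (e : LocalizedModule S M ≃ₗ[Localization S] Localization S) :
    ∃ g : M, ∀ x : M, ∃ s ∈ S, ∃ a : R, s • x = a • g := by
  obtain ⟨⟨g, t⟩, hg⟩ := Quotient.exists_rep (e.symm 1)
  change LocalizedModule.mk g t = e.symm 1 at hg
  refine ⟨g, fun x ↦ ?_⟩
  obtain ⟨a, u, ha⟩ := IsLocalization.exists_mk'_eq S (e (LocalizedModule.mk x 1))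
  have hx : LocalizedModule.mk x 1 = Localization.mk a u • LocalizedModule.mk g t := by
    rw [hg, ← map_smul, smul_eq_mul, mul_one, Localization.mk_eq_mk', ha, e.symm_apply_apply]
  rw [LocalizedModule.mk_smul_mk, LocalizedModule.mk_eq] at hx
  obtain ⟨v, hv⟩ := hx
  refine ⟨v * (u * t), (v * (u * t)).2, v * a, ?_⟩
  simpa [Submonoid.smul_def, mul_smul] using hv

/-- If `S⁻¹M ≅ S⁻¹R`, then an element of `R` annihilating `M` is killed by an element of `S`. -/
theorem LocalizedModule.exists_mul_eq_zero_of_equiv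
    (e : LocalizedModule S M ≃ₗ[Localization S] Localization S) (q : R)
    (hq : ∀ x : M, q • x = 0) : ∃ s ∈ S, s * q = 0 := by
  have h : q • e.symm 1 = 0 := by
    induction e.symm 1 using LocalizedModule.induction_on with
    | h m s => rw [LocalizedModule.smul'_mk, hq, LocalizedModule.zero_mk]
  have h' : algebraMap R (Localization S) q = 0 := by
    rw [← algebraMap_smul (Localization S), ← map_smul, smul_eq_mul, mul_one] at h
    simpa using h
  obtain ⟨s, hs⟩ := (IsLocalization.map_eq_zero_iff S (Localization S) q).mp h'
  exact ⟨s, s.2, hs⟩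

end Localization

section Cyclic

variable {R M : Type*} [CommRing R] [AddCommGroup M] [Module R M]

/-- If the swap of `M ⊗ M` is the identity, then `M` is cyclic modulo every maximal ideal. -/
theorem exists_span_singleton_sup_smul_top_of_tmul_comm (h : ∀ x y : M, x ⊗ₜ[R] y = y ⊗ₜ[R] x)
    (n : Ideal R) [n.IsMaximal] : ∃ x : M, R ∙ x ⊔ n • (⊤ : Submodule R M) = ⊤ := by
  by_cases hn : n • (⊤ : Submodule R M) = ⊤
  · exact ⟨0, by simp [hn]⟩
  obtain ⟨x, -, hx⟩ := SetLike.exists_of_lt (lt_top_iff_ne_top.mpr hn)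
  refine ⟨x, eq_top_iff.mpr fun y _ ↦ ?_⟩
  let := Ideal.Quotient.field n
  let V := M ⧸ n • (⊤ : Submodule R M)
  have hx' : (Submodule.Quotient.mk x : V) ≠ 0 := by
    rwa [Ne, Submodule.Quotient.mk_eq_zero]
  obtain ⟨f, hf⟩ := Module.Projective.exists_dual_ne_zero (R ⧸ n) hx'
  let g : M →ₗ[R] M →ₗ[R] V := LinearMap.mk₂ R
    (fun a b ↦ f (Submodule.Quotient.mk a) • (Submodule.Quotient.mk b : V))
    (fun a b c ↦ by simp [add_smul])
    (fun r a b ↦ by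
      rw [← Module.Quotient.mk_smul_mk, map_smul, smul_eq_mul, mul_smul]
      rfl)
    (fun a b c ↦ by simp)
    (fun r a b ↦ by
      rw [← Module.Quotient.mk_smul_mk, smul_comm]
      rfl)
  have key : f (Submodule.Quotient.mk x) • (Submodule.Quotient.mk y : V) =
      f (Submodule.Quotient.mk y) • (Submodule.Quotient.mk x : V) :=
    congrArg (TensorProduct.lift g) (h x y)
  obtain ⟨c, hc⟩ := Ideal.Quotient.mk_surjective
    ((f (Submodule.Quotient.mk x))⁻¹ * f (Submodule.Quotient.mk y))
  have hy : (Submodule.Quotient.mk y : V) = Submodule.Quotient.mk (c • x) := by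
    rw [← Module.Quotient.mk_smul_mk, hc, mul_smul, ← key, inv_smul_smul₀ hf]
  rw [Submodule.Quotient.eq] at hy
  exact Submodule.mem_sup.mpr
    ⟨c • x, Submodule.smul_mem _ _ (Submodule.mem_span_singleton_self x), _, hy, by abel⟩

/-- A submodule of a finite module which is everything modulo each maximal ideal is everything. -/
theorem Submodule.eq_top_of_forall_sup_smul_top_eq_top [Module.Finite R M] (N : Submodule R M)
    (h : ∀ n : Ideal R, n.IsMaximal → N ⊔ n • (⊤ : Submodule R M) = ⊤) : N = ⊤ := by
  by_contra hN
  have hann : Module.annihilator R (M ⧸ N) ≠ ⊤ := by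
    rwa [Ne, Module.annihilator_eq_top_iff, Submodule.Quotient.subsingleton_iff]
  obtain ⟨n, hn, hle⟩ := Ideal.exists_le_maximal _ hann
  obtain ⟨r, hr, hr'⟩ := Submodule.exists_sub_one_mem_and_smul_eq_zero_of_fg_of_le_smul n
    (⊤ : Submodule R (M ⧸ N)) Module.Finite.fg_top (by
      rw [← N.range_mkQ, ← Submodule.map_top, ← Submodule.map_smul'', ← h n hn,
        Submodule.map_sup, h n hn]
      simp)
  have hrn : r ∈ n := hle (Module.mem_annihilator.mpr fun x ↦ hr' x trivial)
  exact hn.ne_top ((Ideal.eq_top_iff_one n).mpr (by simpa using n.sub_mem hrn hr))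

/-- Over a semilocal ring, a finite module which is cyclic modulo each maximal ideal is cyclic. -/
theorem exists_span_singleton_eq_top_of_forall_maximal [Finite (MaximalSpectrum R)]
    [Module.Finite R M]
    (h : ∀ n : Ideal R, n.IsMaximal → ∃ x : M, R ∙ x ⊔ n • (⊤ : Submodule R M) = ⊤) :
    ∃ x : M, R ∙ x = ⊤ := by
  classical
  have := Fintype.ofFinite (MaximalSpectrum R)
  choose x hx using fun n : MaximalSpectrum R ↦ h n.1 n.2
  have hcrt (i : MaximalSpectrum R) : ∃ r : R, ∀ n : MaximalSpectrum R,
      r - (if i = n then 1 else 0) ∈ n.asIdeal :=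
    Ideal.exists_forall_sub_mem_ideal
      (fun _ _ ne ↦ Ideal.isCoprime_of_isMaximal (MaximalSpectrum.ext_iff.ne.mp ne)) _
  choose e he using hcrt
  refine ⟨∑ i, e i • x i, Submodule.eq_top_of_forall_sup_smul_top_eq_top _ fun n hn ↦ ?_⟩
  have hmem : ∑ i, e i • x i - x ⟨n, hn⟩ ∈ n • (⊤ : Submodule R M) := by
    have hsum : ∑ i, e i • x i - x ⟨n, hn⟩ =
        ∑ i, (e i - if i = ⟨n, hn⟩ then 1 else 0) • x i := by
      simp [sub_smul]
    rw [hsum]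
    exact Submodule.sum_mem _ fun i _ ↦ Submodule.smul_mem_smul (he i ⟨n, hn⟩) trivial
  generalize ∑ i, e i • x i = z at hmem ⊢
  refine eq_top_iff.mpr ((hx ⟨n, hn⟩).ge.trans (sup_le ?_ le_sup_right))
  rw [Submodule.span_singleton_le_iff_mem, ← sub_sub_cancel z (x ⟨n, hn⟩)]
  exact Submodule.sub_mem _ (Submodule.mem_sup_left (Submodule.mem_span_singleton_self z))
    (Submodule.mem_sup_right hmem)

end Cyclic

/-- A finite algebra over a local ring is semilocal. -/
theorem finite_maximalSpectrum_of_finite_of_isLocalRing (R A : Type*) [CommRing R] [IsLocalRing R]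
    [CommRing A] [Algebra R A] [Module.Finite R A] : Finite (MaximalSpectrum A) := by
  have hfin := Algebra.QuasiFinite.finite_primesOver (S := A) (IsLocalRing.maximalIdeal R)
  refine (hfin.to_subtype).of_injective (β := (IsLocalRing.maximalIdeal R).primesOver A)
    (fun n ↦ ⟨n.asIdeal, n.isMaximal.isPrime, ⟨?_⟩⟩) fun a b hab ↦ ?_
  · have := n.isMaximal
    exact (IsLocalRing.eq_maximalIdeal
      (Ideal.isMaximal_comap_of_isIntegral_of_isMaximal (R := R) n.asIdeal)).symm
  · exact MaximalSpectrum.ext (congrArg Subtype.val hab)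


/-- Let `P → Q` be a finite homomorphism of commutative rings with `P`
noetherian local, and let `N` be a finitely generated `Q`-module.  If
`Ass_P (N ⊗_Q N) ∪ Ass_P Q ⊆ Ass P` and `N_p ≅ Q_p` as `Q_p`-modules for every prime
`p ∈ Ass P`, then `N ≅ Q` as `Q`-modules. -/
theorem module_iso_of_associated_primes_and_generic_iso
    (P Q : Type) [CommRing P] [IsNoetherianRing P] [IsLocalRing P]
    [CommRing Q] [Algebra P Q] [Module.Finite P Q]
    (N : Type) [AddCommGroup N] [Module Q N] [Module.Finite Q N]
    [Module P N] [IsScalarTower P Q N]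
    (hass : associatedPrimes P (TensorProduct Q N N) ∪ associatedPrimes P Q ⊆
      associatedPrimes P P)
    (hloc : ∀ (p : Ideal P) (hp : p.IsPrime), p ∈ associatedPrimes P P →
      Nonempty (LocalizedModule ((@Ideal.primeCompl P _ p hp).map (algebraMap P Q)) N
        ≃ₗ[Localization ((@Ideal.primeCompl P _ p hp).map (algebraMap P Q))]
        Localization ((@Ideal.primeCompl P _ p hp).map (algebraMap P Q)))) :
    Nonempty (N ≃ₗ[Q] Q) := by
  have hcomm (x y : N) : x ⊗ₜ[Q] y = y ⊗ₜ[Q] x := by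
    rw [← sub_eq_zero]
    refine eq_zero_of_forall_associatedPrimes_exists_smul_eq_zero (R := P) _ fun p hp ↦ ?_
    obtain ⟨e⟩ := hloc p hp.isPrime (hass (.inl hp))
    obtain ⟨g, hg⟩ := LocalizedModule.exists_forall_smul_eq_smul_of_equiv _ e
    obtain ⟨_, ⟨s, hs, rfl⟩, a, ha⟩ := hg x
    obtain ⟨_, ⟨t, ht, rfl⟩, b, hb⟩ := hg y
    refine ⟨s * t, fun h ↦ (hp.isPrime.mem_or_mem h).elim hs ht, ?_⟩
    rw [← algebraMap_smul Q, map_mul, smul_sub, sub_eq_zero]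
    have h₁ := TensorProduct.smul_tmul_smul (algebraMap P Q s) (algebraMap P Q t) x y
    have h₂ := TensorProduct.smul_tmul_smul (algebraMap P Q t) (algebraMap P Q s) y x
    change algebraMap P Q s • x = a • g at ha
    change algebraMap P Q t • y = b • g at hb
    rw [ha, hb] at h₁ h₂
    rw [← h₁, mul_comm, ← h₂, TensorProduct.smul_tmul_smul, TensorProduct.smul_tmul_smul, mul_comm]
  have := finite_maximalSpectrum_of_finite_of_isLocalRing P Q
  obtain ⟨x, hx⟩ := exists_span_singleton_eq_top_of_forall_maximal fun n _ ↦
    exists_span_singleton_sup_smul_top_of_tmul_comm hcomm n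
  refine ⟨(LinearEquiv.ofBijective (LinearMap.toSpanSingleton Q N x) ⟨?_, ?_⟩).symm⟩
  · refine (injective_iff_map_eq_zero _).mpr fun q hq ↦ ?_
    refine eq_zero_of_forall_associatedPrimes_exists_smul_eq_zero (R := P) _ fun p hp ↦ ?_
    obtain ⟨e⟩ := hloc p hp.isPrime (hass (.inr hp))
    have hann (y : N) : q • y = 0 := by
      obtain ⟨a, rfl⟩ := Submodule.mem_span_singleton.mp (hx ▸ Submodule.mem_top : y ∈ Q ∙ x)
      rw [smul_comm, show q • x = 0 from hq, smul_zero]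
    obtain ⟨_, ⟨s, hs, rfl⟩, hsq⟩ := LocalizedModule.exists_mul_eq_zero_of_equiv _ e q hann
    exact ⟨s, hs, by rw [Algebra.smul_def]; exact hsq⟩
  · rw [← LinearMap.range_eq_top, LinearMap.range_toSpanSingleton, hx]
end
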